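/- Let H be the set of all n-cycles in A_n when n > 4 is odd, and the set of all (n−1)-cycles in A_n when n > 5 is even. Then H is a connecting set in A_n, and the second largest eigenvalue of the Cayley graph Cay(A_n, H) equals 2·(n−3)! when n is odd, and 3(n−3)·(n−5)! when n is even. -/

import Mathlib

open Equiv

/-- The Cayley graph of a subset `H` of a group `G`. -/
def cayleyGraph {G : Type*} [Group G] (H : Set G) : SimpleGraph G :=
  SimpleGraph.fromRel (fun u v => u * v⁻¹ ∈ H)

/-- The set of (real) eigenvalues of a finite graph. -/
noncomputable def graphEigs {V : Type*} [Finite V] (Γ : SimpleGraph V) : Set ℝ := by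
  classical
  letI : Fintype V := Fintype.ofFinite V
  exact spectrum ℝ (Γ.adjMatrix ℝ)

/-- The set of `k`-cycles, as a subset of `A_n`. -/
def kCyclesAlt (n k : ℕ) : Set (alternatingGroup (Fin n)) :=
  {g : alternatingGroup (Fin n) |
    (g : Perm (Fin n)).IsCycle ∧ (g : Perm (Fin n)).support.card = k}

/-- Closure properties of the set of joint spectra of the Jucys–Murphy elements of `S_n`. -/
structure AdmissibleSpectra (n : ℕ) (S : Set (ℕ → ℝ)) : Prop where
  zero : ∀ c ∈ S, c 0 = 0
  one_le : ∀ c ∈ S, ∀ i, i + 1 < n → 1 ≤ |c (i + 1) - c i|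
  swap : ∀ c ∈ S, ∀ i, i + 1 < n → 1 < |c (i + 1) - c i| → c ∘ Equiv.swap i (i + 1) ∈ S
  no_triple : ∀ c ∈ S, ∀ i, i + 2 < n → |c (i + 1) - c i| = 1 → c (i + 2) ≠ c i

/-- `HookContents c m p q`: the sequence `c 0, …, c m` is the content sequence of a standard
tableau of hook shape with arm length `p` and leg length `q`. -/
inductive HookContents (c : ℕ → ℝ) : ℕ → ℕ → ℕ → Prop
  | zero : c 0 = 0 → HookContents c 0 0 0
  | arm {m p q : ℕ} : HookContents c m p q → c (m + 1) = p + 1 → HookContents c (m + 1) (p + 1) q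
  | leg {m p q : ℕ} : HookContents c m p q → c (m + 1) = -(q + 1) →
      HookContents c (m + 1) p (q + 1)

namespace HookContents

variable {c c' : ℕ → ℝ} {m p q : ℕ}

theorem congr (h : HookContents c m p q) (hc : ∀ i ≤ m, c' i = c i) : HookContents c' m p q := by
  induction h with
  | zero h0 => exact .zero (by rw [hc 0 le_rfl, h0])
  | arm h h1 ih => exact .arm (ih fun i hi => hc i (by omega)) (by rw [hc _ le_rfl, h1])
  | leg h h1 ih => exact .leg (ih fun i hi => hc i (by omega)) (by rw [hc _ le_rfl, h1])

theorem neg (h : HookContents c m p q) : HookContents (-c) m q p := by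
  induction h with
  | zero h0 => exact .zero (by simp [h0])
  | arm h h1 ih => exact .leg ih (by simp [h1])
  | leg h h1 ih => exact .arm ih (by simp [h1])

theorem add_eq (h : HookContents c m p q) : p + q = m := by
  induction h with
  | zero => rfl
  | arm _ _ ih => omega
  | leg _ _ ih => omega

theorem prod_eq (h : HookContents c m p q) :
    ∏ i ∈ Finset.range m, c (i + 1) = (-1) ^ q * p.factorial * q.factorial := by
  induction h with
  | zero => simp
  | arm _ h1 ih => rw [Finset.prod_range_succ, ih, h1, Nat.factorial_succ]; push_cast; ring
  | leg _ h1 ih => rw [Finset.prod_range_succ, ih, h1, Nat.factorial_succ]; push_cast; ring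

theorem sum_eq (h : HookContents c m p q) :
    ∑ i ∈ Finset.range m, c (i + 1) = ((p : ℝ) - q) * (p + q + 1) / 2 := by
  induction h with
  | zero => simp
  | arm _ h1 ih => rw [Finset.sum_range_succ, ih, h1]; push_cast; ring
  | leg _ h1 ih => rw [Finset.sum_range_succ, ih, h1]; push_cast; ring

theorem last (h : HookContents c (m + 1) p q) :
    (c (m + 1) = p ∧ 1 ≤ p) ∨ (c (m + 1) = -q ∧ 1 ≤ q) := by
  cases h with
  | arm _ h1 => left; simp [h1]
  | leg _ h1 => right; simp [h1]

end HookContents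

theorem AdmissibleSpectra.neg {n : ℕ} {S : Set (ℕ → ℝ)} (hS : AdmissibleSpectra n S) :
    AdmissibleSpectra n {c | -c ∈ S} := by
  have key : ∀ (c : ℕ → ℝ) i j, |(-c) i - (-c) j| = |c i - c j| := by
    intro c i j
    rw [← abs_neg]; congr 1; simp only [Pi.neg_apply]; ring
  refine ⟨fun c hc => by simpa using hS.zero _ hc, fun c hc i hi => ?_, fun c hc i hi h => ?_,
    fun c hc i hi h h' => ?_⟩
  · rw [← key]; exact hS.one_le _ hc i hi
  · rw [← key] at h; exact hS.swap _ hc i hi h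
  · rw [← key] at h; exact hS.no_triple _ hc i hi h (by simp [h'])

/-- The possible contents of a box added to a hook with arm length `p` and leg length `q`. -/
def IsNextContent (x : ℝ) (p q : ℕ) : Prop :=
  x = p + 1 ∨ x = -(q + 1) ∨ (x = 0 ∧ 1 ≤ p ∧ 1 ≤ q)

theorem IsNextContent.neg {x : ℝ} {p q : ℕ} (h : IsNextContent x p q) :
    IsNextContent (-x) q p := by
  rcases h with h | h | ⟨h, h1, h2⟩
  · right; left; rw [h]
  · left; rw [h]; ring
  · right; right; exact ⟨by rw [h]; simp, h2, h1⟩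

theorem AdmissibleSpectra.isNextContent_of_arm {n : ℕ} {S : Set (ℕ → ℝ)}
    (hS : AdmissibleSpectra n S) {m : ℕ}
    (ih : ∀ m' ≤ m, ∀ c ∈ S, ∀ p q, HookContents c m' p q → m' + 1 < n →
      IsNextContent (c (m' + 1)) p q)
    {c : ℕ → ℝ} (hc : c ∈ S) {p q : ℕ} (h : HookContents c m p q) (h1 : c (m + 1) = p + 1)
    (hm : m + 2 < n) : IsNextContent (c (m + 2)) (p + 1) q := by
  have h2 := hS.one_le c hc (m + 1) hm
  rcases h2.lt_or_eq with h2 | h2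
  · have h3 := hS.swap c hc (m + 1) hm h2
    have h4 := ih m le_rfl _ h3 p q (h.congr fun i hi => by
      simp [Equiv.swap_apply_of_ne_of_ne (show i ≠ m + 1 by omega) (show i ≠ m + 1 + 1 by omega)])
      (by omega)
    simp only [Function.comp_apply, Equiv.swap_apply_left] at h4
    rcases h4 with h4 | h4 | ⟨h4, h5, h6⟩
    · exfalso
      rw [h4, h1] at h2
      simp at h2
      linarith
    · exact .inr (.inl h4)
    · exact .inr (.inr ⟨h4, by omega, h6⟩)
  · have h3 : c (m + 2) = p + 1 + 1 ∨ c (m + 2) = p := by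
      rcases eq_or_eq_neg_of_abs_eq h2.symm with h | h
      · left; rw [show m + 2 = m + 1 + 1 from rfl]; linarith
      · right; rw [show m + 2 = m + 1 + 1 from rfl]; linarith
    rcases h3 with h3 | h3
    · left; rw [h3]; push_cast; ring
    cases h with
    | zero h0 => exact absurd (by simp [h3, h0]) (hS.no_triple c hc 0 hm (by simp [h1, h0]))
    | @arm m p q h h4 =>
      exact absurd (by rw [h3, h4]; push_cast; ring)
        (hS.no_triple c hc (m + 1) hm (by rw [h1, h4]; push_cast; simp))
    | @leg m p q h h4 =>
      rcases Nat.eq_zero_or_pos p with rfl | hp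
      · right; right; simp [h3]
      exfalso
      have hp' : (1 : ℝ) ≤ p := by exact_mod_cast hp
      have hq' : (0 : ℝ) ≤ q := q.cast_nonneg
      have s1 := hS.swap c hc (m + 1) (by omega) (by
        rw [h1, h4, abs_of_pos] <;> linarith)
      set c1 := c ∘ Equiv.swap (m + 1) (m + 1 + 1) with hc1
      have e1 : c1 (m + 1) = p + 1 := by simp [hc1, h1]
      have e2 : c1 (m + 2) = -(q + 1) := by simp [hc1, ← h4]
      have e3 : c1 (m + 3) = p := by
        simp [hc1, Equiv.swap_apply_of_ne_of_ne (show m + 3 ≠ m + 1 by omega)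
          (show m + 3 ≠ m + 1 + 1 by omega), ← h3]
      have s2 := hS.swap c1 s1 (m + 2) (by omega) (by
        rw [show m + 2 + 1 = m + 3 from rfl, e2, e3, abs_of_pos] <;> linarith)
      set c2 := c1 ∘ Equiv.swap (m + 2) (m + 2 + 1) with hc2
      have f0 : ∀ i ≤ m, c2 i = c i := fun i hi => by
        simp [hc2, hc1, Equiv.swap_apply_of_ne_of_ne (show i ≠ m + 2 by omega)
          (show i ≠ m + 2 + 1 by omega), Equiv.swap_apply_of_ne_of_ne (show i ≠ m + 1 by omega)
          (show i ≠ m + 1 + 1 by omega)]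
      have f1 : c2 (m + 1) = p + 1 := by
        simp [hc2, Equiv.swap_apply_of_ne_of_ne (show m + 1 ≠ m + 2 by omega)
          (show m + 1 ≠ m + 2 + 1 by omega), e1]
      have f2 : c2 (m + 1 + 1) = p := by simp [hc2, e3]
      have := ih (m + 1) le_rfl c2 s2 (p + 1) q ((h.congr f0).arm f1) (by omega)
      rw [f2] at this
      rcases this with h | h | ⟨h, _⟩
      · push_cast at h; linarith
      · linarith
      · linarith

theorem AdmissibleSpectra.isNextContent {n : ℕ} {S : Set (ℕ → ℝ)} (hS : AdmissibleSpectra n S)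
    (m : ℕ) : ∀ c ∈ S, ∀ p q, HookContents c m p q → m + 1 < n →
      IsNextContent (c (m + 1)) p q := by
  induction m using Nat.strong_induction_on with
  | _ m ih =>
    intro c hc p q h hm
    cases h with
    | zero h0 =>
      rcases (hS.one_le c hc 0 hm).lt_or_eq with h2 | h2
      · have := hS.zero _ (hS.swap c hc 0 hm h2)
        simp at this
        rw [h0, zero_add, this] at h2
        norm_num at h2
      · rw [h0, sub_zero] at h2
        rcases eq_or_eq_neg_of_abs_eq h2.symm with h | h
        · left; simpa using h
        · right; left; simpa using h
    | @arm m p q h h1 =>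
      exact hS.isNextContent_of_arm (fun m' hm' => ih m' (by omega)) hc h h1 hm
    | @leg m p q h h1 =>
      have := hS.neg.isNextContent_of_arm (m := m) (fun m' hm' c hc p q h hm => by
          simpa using (ih m' (by omega) _ hc q p h.neg hm).neg)
        (c := -c) (by simpa using hc) h.neg (by simp [h1]) hm
      simpa using this.neg

theorem AdmissibleSpectra.exists_hookContents {n : ℕ} {S : Set (ℕ → ℝ)}
    (hS : AdmissibleSpectra n S) {c : ℕ → ℝ} (hc : c ∈ S) (m : ℕ) (hm : m < n)
    (h : ∏ i ∈ Finset.range m, c (i + 1) ≠ 0) : ∃ p q, HookContents c m p q := by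
  induction m with
  | zero => exact ⟨0, 0, .zero (hS.zero c hc)⟩
  | succ m ih =>
    rw [Finset.prod_range_succ] at h
    obtain ⟨p, q, hpq⟩ := ih (by omega) (left_ne_zero_of_mul h)
    rcases hS.isNextContent m c hc p q hpq hm with h1 | h1 | ⟨h1, _⟩
    · exact ⟨_, _, hpq.arm h1⟩
    · exact ⟨_, _, hpq.leg h1⟩
    · exact absurd h1 (right_ne_zero_of_mul h)

section JucysMurphy

variable {n : ℕ} {R : Type*} [Ring R] (ρ : Perm (Fin n) →* R)

/-- The image of the Jucys–Murphy element `∑ i < k, (i k)` under a homomorphism. -/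
def jm (k : Fin n) : R := ∑ i ∈ Finset.Iio k, ρ (swap i k)

theorem commute_jm {k : Fin n} {g : Perm (Fin n)} (hk : g k = k) (hg : ∀ i, g i < k ↔ i < k) :
    Commute (ρ g) (jm ρ k) := by
  unfold jm Commute SemiconjBy
  rw [Finset.mul_sum, Finset.sum_mul]
  refine Finset.sum_equiv g (fun i => by simp [hg]) fun i _ => ?_
  rw [← map_mul, ← map_mul, mul_swap_eq_swap_mul, hk]

theorem jm_commute_jm (j k : Fin n) : Commute (jm ρ j) (jm ρ k) := by
  wlog h : j < k generalizing j k
  · rcases (not_lt.mp h).eq_or_lt with rfl | h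
    · exact Commute.refl _
    · exact (this k j h).symm
  refine Commute.sum_left _ _ _ fun i hi => commute_jm ρ ?_ fun x => ?_
  · rw [Finset.mem_Iio] at hi
    exact swap_apply_of_ne_of_ne (by omega) (by omega)
  · rw [Finset.mem_Iio] at hi
    rw [swap_apply_def]
    split_ifs with h1 h2
    · subst h1; exact iff_of_true h (hi.trans h)
    · subst h2; exact iff_of_true (hi.trans h) h
    · rfl

theorem swap_mul_jm_mul_swap {k l : Fin n} (h : (k : ℕ) + 1 = l) :
    ρ (swap k l) * jm ρ k * ρ (swap k l) = jm ρ l - ρ (swap k l) := by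
  have h1 : Finset.Iio l = insert k (Finset.Iio k) := by
    ext i; rw [Finset.mem_insert, Finset.mem_Iio, Finset.mem_Iio]; omega
  unfold jm
  rw [h1, Finset.sum_insert (by simp), add_sub_cancel_left, Finset.mul_sum, Finset.sum_mul]
  refine Finset.sum_congr rfl fun i hi => ?_
  rw [Finset.mem_Iio, Fin.lt_def] at hi
  rw [← map_mul, ← map_mul, mul_swap_eq_swap_mul (swap k l) i k, swap_apply_left,
    swap_apply_of_ne_of_ne (by rw [Ne, Fin.ext_iff]; omega) (by rw [Ne, Fin.ext_iff]; omega),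
    mul_assoc, swap_mul_self, mul_one]

/-- `g` permutes the points `0, …, m` in a single cycle and fixes all other points. -/
def IsFullCycle (m : ℕ) (g : Perm (Fin n)) : Prop :=
  (∀ j : Fin n, m < j → g j = j) ∧ ∀ x y : Fin n, (x : ℕ) ≤ m → (y : ℕ) ≤ m → g.SameCycle x y

theorem IsFullCycle.le_iff {m : ℕ} {g : Perm (Fin n)} (hg : IsFullCycle m g) (x : Fin n) :
    (g x : ℕ) ≤ m ↔ (x : ℕ) ≤ m := by
  rw [← not_lt, ← not_lt, not_iff_not]
  refine ⟨fun h => ?_, fun h => by rwa [hg.1 x h]⟩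
  rwa [g.injective (hg.1 _ h)] at h

theorem isFullCycle_zero_iff {g : Perm (Fin n)} : IsFullCycle 0 g ↔ g = 1 := by
  refine ⟨fun h => ?_, ?_⟩
  · ext x
    rcases Nat.eq_zero_or_pos (x : ℕ) with hx | hx
    · have := (h.le_iff x).2 (by omega)
      rw [Perm.one_apply]
      omega
    · rw [h.1 x hx, Perm.one_apply]
  · rintro rfl
    refine ⟨fun _ _ => rfl, fun x y hx hy => ?_⟩
    rw [show x = y by ext; omega]

theorem IsFullCycle.conj {m : ℕ} {g h : Perm (Fin n)} (hg : IsFullCycle m g)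
    (hh : ∀ x : Fin n, (h x : ℕ) ≤ m ↔ (x : ℕ) ≤ m) : IsFullCycle m (h * g * h⁻¹) := by
  have hh' : ∀ x : Fin n, (h⁻¹ x : ℕ) ≤ m ↔ (x : ℕ) ≤ m := fun x => by
    rw [← hh (h⁻¹ x), ← Perm.mul_apply, mul_inv_cancel, Perm.one_apply]
  refine ⟨fun j hj => ?_, fun x y hx hy => ?_⟩
  · rw [Perm.mul_apply, Perm.mul_apply, hg.1, ← Perm.mul_apply, mul_inv_cancel, Perm.one_apply]
    rw [← not_le, hh' j]; omega
  · rw [Perm.sameCycle_conj]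
    exact hg.2 _ _ ((hh' _).2 hx) ((hh' _).2 hy)

theorem IsFullCycle.swap_mul {m : ℕ} {g : Perm (Fin n)} (hg : IsFullCycle m g)
    {i k : Fin n} (hk : (k : ℕ) = m + 1) (hi : i < k) : IsFullCycle (m + 1) (swap i k * g) := by
  rw [Fin.lt_def] at hi
  have hgk : g k = k := hg.1 k (by omega)
  have hk' : (swap i k * g) k = i := by simp [hgk]
  have step : ∀ x, x ≠ k → (swap i k * g).SameCycle x (g x) := by
    intro x hx
    by_cases hxi : g x = i
    · refine ⟨2, ?_⟩
      rw [zpow_two, Perm.mul_apply, Perm.mul_apply (swap i k) g x, hxi, swap_apply_left, hk']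
    · refine ⟨1, ?_⟩
      rw [zpow_one, Perm.mul_apply, swap_apply_of_ne_of_ne hxi]
      rwa [← hgk, g.injective.ne_iff]
  have hne : ∀ x : Fin n, (x : ℕ) ≤ m → ∀ j : ℕ, (swap i k * g).SameCycle x ((g ^ j) x) := by
    intro x hx j
    induction j with
    | zero => exact .refl _ _
    | succ j ih =>
      rw [pow_succ', Perm.mul_apply]
      refine ih.trans (step _ fun h => ?_)
      have : ∀ j, (((g ^ j) x : Fin n) : ℕ) ≤ m := by
        intro j
        induction j with
        | zero => simpa
        | succ j ih => rw [pow_succ', Perm.mul_apply, hg.le_iff]; exact ih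
      have := this j
      rw [h] at this; omega
  have key : ∀ x : Fin n, (x : ℕ) ≤ m + 1 → (swap i k * g).SameCycle i x := by
    intro x hx
    rcases Nat.lt_or_ge m x with h | h
    · rw [show x = k by ext; omega]
      exact (Perm.SameCycle.symm ⟨1, by rw [zpow_one, hk']⟩)
    · obtain ⟨j, hj⟩ := (hg.2 i x (by omega) h).exists_nat_pow_eq
      rw [← hj]
      exact hne i (by omega) j
  refine ⟨fun j hj => ?_, fun x y hx hy => (key x hx).symm.trans (key y hy)⟩
  rw [Perm.mul_apply, hg.1 j (by omega), swap_apply_of_ne_of_ne] <;>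
    rw [Ne, Fin.ext_iff] <;> omega

theorem IsFullCycle.apply_lt {m : ℕ} {g : Perm (Fin n)} (hg : IsFullCycle (m + 1) g)
    {k : Fin n} (hk : (k : ℕ) = m + 1) : g k < k := by
  have h1 := (hg.le_iff k).2 hk.le
  rw [Fin.lt_def]
  refine lt_of_le_of_ne (by omega) fun h => ?_
  rw [← Fin.ext_iff] at h
  have h2 := hg.2 k ⟨0, by have := k.isLt; omega⟩ hk.le (by simp)
  have h3 := h2.eq_of_left h
  rw [Fin.ext_iff] at h3
  simp only at h3
  omega

theorem IsFullCycle.swap_apply_mul {m : ℕ} {g : Perm (Fin n)} (hg : IsFullCycle (m + 1) g)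
    {k : Fin n} (hk : (k : ℕ) = m + 1) : IsFullCycle m (swap (g k) k * g) := by
  have hgk := hg.apply_lt hk
  have key : ∀ j : ℕ, ∀ x y : Fin n, x ≠ k → y ≠ k → (g ^ j) x = y →
      (swap (g k) k * g).SameCycle x y := by
    intro j
    induction j using Nat.strong_induction_on with
    | _ j ih =>
      intro x y hx hy h
      rcases j with _ | j
      · simp only [pow_zero, Perm.one_apply] at h; rw [h]
      by_cases hxk : g x = k
      · rcases j with _ | j
        · rw [zero_add, pow_one, hxk] at h; exact absurd h.symm hy
        · refine Perm.SameCycle.trans ⟨1, ?_⟩ (ih j (by omega) (g k) y hgk.ne hy ?_)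
          · rw [zpow_one, Perm.mul_apply, hxk, swap_apply_right]
          · rw [← h, pow_succ, pow_succ, Perm.mul_apply, Perm.mul_apply, hxk]
      · refine Perm.SameCycle.trans ⟨1, ?_⟩ (ih j (by omega) (g x) y hxk hy ?_)
        · rw [zpow_one, Perm.mul_apply, swap_apply_of_ne_of_ne (fun h => hx (g.injective h)) hxk]
        · rw [← h, pow_succ, Perm.mul_apply]
  refine ⟨fun j hj => ?_, fun x y hx hy => ?_⟩
  · rcases Nat.lt_or_ge (m + 1) j with h | h
    · rw [Perm.mul_apply, hg.1 j h, swap_apply_of_ne_of_ne]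
      · rw [Ne, Fin.ext_iff]; rw [Fin.lt_def] at hgk; omega
      · rw [Ne, Fin.ext_iff]; omega
    · rw [show j = k by ext; omega]; simp
  · obtain ⟨j, hj⟩ := (hg.2 x y (by omega) (by omega)).exists_nat_pow_eq
    refine key j x y ?_ ?_ hj <;> rw [Ne, Fin.ext_iff] <;> omega

theorem isFullCycle_iff_isCycle {m : ℕ} (hm : 0 < m) (hmn : m < n) {g : Perm (Fin n)} :
    IsFullCycle m g ↔ g.IsCycle ∧ ∀ x, x ∈ g.support ↔ (x : ℕ) ≤ m := by
  refine ⟨fun h => ?_, fun ⟨h1, h2⟩ => ⟨fun j hj => ?_, fun x y hx hy => ?_⟩⟩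
  · have hs : ∀ x : Fin n, g x ≠ x ↔ (x : ℕ) ≤ m := by
      refine fun x => ⟨fun hx => ?_, fun hx hgx => ?_⟩
      · by_contra hlt
        exact hx (h.1 x (by omega))
      · have h0 := (h.2 x ⟨0, by omega⟩ hx (by simp)).eq_of_left hgx
        have h1 := (h.2 x ⟨1, by omega⟩ hx (by simp; omega)).eq_of_left hgx
        simpa using congrArg Fin.val (h0.symm.trans h1)
    refine ⟨⟨⟨0, by omega⟩, (hs _).2 (by simp), fun y hy => h.2 _ _ (by simp) ((hs _).1 hy)⟩,
      fun x => by rw [Perm.mem_support, hs]⟩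
  · by_contra hne
    exact absurd ((h2 j).1 (Perm.mem_support.2 hne)) (by omega)
  · exact h1.sameCycle (Perm.mem_support.1 ((h2 x).2 hx)) (Perm.mem_support.1 ((h2 y).2 hy))

open Classical in
/-- The sum of all cycles on the points `0, …, m`. -/
noncomputable def cycleSum (m : ℕ) : R :=
  ∑ g ∈ Finset.univ.filter (fun g : Perm (Fin n) => IsFullCycle m g), ρ g

theorem cycleSum_zero : cycleSum ρ 0 = 1 := by
  simp [cycleSum, isFullCycle_zero_iff, Finset.filter_eq']

theorem cycleSum_succ {m : ℕ} {k : Fin n} (hk : (k : ℕ) = m + 1) :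
    cycleSum ρ (m + 1) = jm ρ k * cycleSum ρ m := by
  classical
  unfold cycleSum jm
  rw [Finset.sum_mul_sum, ← Finset.sum_product']
  symm
  refine Finset.sum_bij' (fun x _ => swap x.1 k * x.2) (fun g _ => (g k, swap (g k) k * g))
    ?_ ?_ ?_ ?_ ?_
  · rintro ⟨i, g⟩ h
    simp only [Finset.mem_product, Finset.mem_Iio, Finset.mem_filter, Finset.mem_univ,
      true_and] at h ⊢
    exact h.2.swap_mul hk h.1
  · intro g h
    simp only [Finset.mem_product, Finset.mem_Iio, Finset.mem_filter, Finset.mem_univ,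
      true_and] at h ⊢
    exact ⟨h.apply_lt hk, h.swap_apply_mul hk⟩
  · rintro ⟨i, g⟩ h
    simp only [Finset.mem_product, Finset.mem_Iio, Finset.mem_filter, Finset.mem_univ,
      true_and] at h
    have : g k = k := h.2.1 k (by omega)
    simp [this]
  · intro g h
    simp
  · rintro ⟨i, g⟩ h
    simp

theorem commute_cycleSum {m : ℕ} {h : Perm (Fin n)}
    (hh : ∀ x : Fin n, (h x : ℕ) ≤ m ↔ (x : ℕ) ≤ m) : Commute (ρ h) (cycleSum ρ m) := by
  classical
  have hh' : ∀ x : Fin n, (h⁻¹ x : ℕ) ≤ m ↔ (x : ℕ) ≤ m := fun x => by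
    rw [← hh (h⁻¹ x), ← Perm.mul_apply, mul_inv_cancel, Perm.one_apply]
  unfold cycleSum Commute SemiconjBy
  rw [Finset.mul_sum, Finset.sum_mul]
  refine Finset.sum_bij' (fun g _ => h * g * h⁻¹) (fun g _ => h⁻¹ * g * h) ?_ ?_ ?_ ?_ ?_
  · intro g hg
    simp only [Finset.mem_filter, Finset.mem_univ, true_and] at hg ⊢
    exact hg.conj hh
  · intro g hg
    simp only [Finset.mem_filter, Finset.mem_univ, true_and] at hg ⊢
    simpa using hg.conj hh'
  · intro g _; group
  · intro g _; group
  · intro g _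
    rw [← map_mul, ← map_mul]
    group

open Classical in
/-- The sum of all cycles of length `k`. -/
noncomputable def cycleClassSum (k : ℕ) : R :=
  ∑ g ∈ Finset.univ.filter (fun g : Perm (Fin n) => g.IsCycle ∧ g.support.card = k), ρ g

theorem cycleClassSum_self (hn : 2 ≤ n) : cycleClassSum ρ n = cycleSum ρ (n - 1) := by
  classical
  unfold cycleClassSum cycleSum
  refine Finset.sum_congr (Finset.filter_congr fun g _ => ?_) fun _ _ => rfl
  rw [isFullCycle_iff_isCycle (by omega) (by omega)]
  refine and_congr_right fun _ => ⟨fun h x => ?_, fun h => ?_⟩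
  · rw [(Finset.card_eq_iff_eq_univ _).1 (h.trans (Fintype.card_fin n).symm)]
    simp; omega
  · rw [(Finset.card_eq_iff_eq_univ g.support).2 (Finset.eq_univ_iff_forall.2 fun x =>
      (h x).2 (by omega)), Fintype.card_fin]

theorem cycleClassSum_pred {m : ℕ} {k : Fin n} (hk : (k : ℕ) = m + 2) (hn : n = m + 3) :
    cycleClassSum ρ (n - 1) =
      ∑ i : Fin n, ρ (swap i k) * cycleSum ρ (m + 1) * ρ (swap i k) := by
  classical
  have hiff : ∀ g : Perm (Fin n), IsFullCycle (m + 1) g ↔ g.IsCycle ∧ g.support = {k}ᶜ := by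
    intro g
    rw [isFullCycle_iff_isCycle (by omega) (by omega), Finset.ext_iff]
    refine and_congr_right fun _ => forall_congr' fun x => ?_
    rw [Finset.mem_compl, Finset.mem_singleton, Fin.ext_iff]
    refine iff_congr Iff.rfl ?_
    omega
  have hconj : ∀ (i : Fin n) (g : Perm (Fin n)), (swap i k * g * swap i k).support =
      g.support.map (swap i k).toEmbedding := fun i g => by
    simpa using Perm.support_conj (σ := swap i k) (τ := g)
  have hmap : ∀ i j : Fin n, ({j}ᶜ : Finset (Fin n)).map (swap i k).toEmbedding =
      {swap i k j}ᶜ := fun i j => by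
    ext x
    simp only [Finset.mem_map_equiv, Finset.mem_compl, Finset.mem_singleton, symm_swap]
    rw [swap_apply_eq_iff]
  unfold cycleClassSum cycleSum
  simp_rw [Finset.mul_sum, Finset.sum_mul]
  rw [← Finset.sum_product']
  symm
  refine Finset.sum_bij (fun x _ => swap x.1 k * x.2 * swap x.1 k) ?_ ?_ ?_ ?_
  · rintro ⟨i, g⟩ h
    simp only [Finset.mem_product, Finset.mem_filter, Finset.mem_univ, true_and, hiff] at h ⊢
    refine ⟨by simpa using h.1.conj (g := swap i k), ?_⟩
    rw [hconj, Finset.card_map, h.2, Finset.card_compl, Finset.card_singleton, Fintype.card_fin]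
  · rintro ⟨i, g⟩ h ⟨i', g'⟩ h' heq
    simp only [Finset.mem_product, Finset.mem_filter, Finset.mem_univ, true_and, hiff] at h h' heq
    have h3 := congrArg Perm.support heq
    rw [hconj, hconj, h.2, h'.2, hmap, hmap, compl_inj_iff, Finset.singleton_inj,
      swap_apply_right, swap_apply_right] at h3
    subst h3
    simpa using heq
  · intro g hg
    simp only [Finset.mem_filter, Finset.mem_univ, true_and] at hg
    have h1 : g.supportᶜ.card = 1 := by
      rw [Finset.card_compl, hg.2, Fintype.card_fin]; omega
    obtain ⟨i, hi⟩ := Finset.card_eq_one.1 h1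
    refine ⟨(i, swap i k * g * swap i k), ?_, ?_⟩
    · simp only [Finset.mem_product, Finset.mem_filter, Finset.mem_univ, true_and, hiff]
      refine ⟨by simpa using hg.1.conj (g := swap i k), ?_⟩
      rw [hconj, ← compl_compl g.support, hi, hmap, swap_apply_left]
    · simp [mul_assoc]
  · rintro ⟨i, g⟩ _
    simp

theorem isCycle_conj_iff {α : Type*} {g h : Perm α} : (h * g * h⁻¹).IsCycle ↔ g.IsCycle :=
  ⟨fun H => by simpa [mul_assoc] using H.conj (g := h⁻¹), fun H => H.conj⟩

theorem commute_cycleClassSum (k : ℕ) (h : Perm (Fin n)) : Commute (ρ h) (cycleClassSum ρ k) := by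
  classical
  unfold cycleClassSum Commute SemiconjBy
  rw [Finset.mul_sum, Finset.sum_mul]
  refine Finset.sum_equiv (MulAut.conj h).toEquiv (fun g => ?_) fun g _ => ?_
  · simp [isCycle_conj_iff]
  · simp [← map_mul]

end JucysMurphy

section NearFullCycles

variable {n : ℕ} {R : Type*} [Ring R] (ρ : Perm (Fin n) →* R)

theorem swap_mul_jm_mul_swap_eq_sum {k l i : Fin n} (hkl : (l : ℕ) + 1 = k) (hi : i < k) :
    ρ (swap i l) * jm ρ l * ρ (swap i l) = ∑ j ∈ (Finset.Iio k).erase i, ρ (swap j i) := by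
  unfold jm
  rw [Finset.mul_sum, Finset.sum_mul]
  refine Finset.sum_equiv (swap i l) (fun j => ?_) fun j _ => ?_
  · rw [Finset.mem_Iio, Finset.mem_erase, Finset.mem_Iio, Ne, swap_apply_eq_iff, swap_apply_left,
      swap_apply_def]
    split_ifs with h1 h2
    · subst h1; omega
    · subst h2; omega
    · omega
  · rw [← map_mul, ← map_mul, mul_swap_eq_swap_mul (swap i l) j l, swap_apply_right, mul_assoc,
      swap_mul_self, mul_one]

/-- Twice the sum of all transpositions of points below `k`. -/
def swapSum (k : Fin n) : R := ∑ i ∈ Finset.Iio k, ∑ j ∈ (Finset.Iio k).erase i, ρ (swap j i)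

theorem commute_swapSum {k : Fin n} {g : Perm (Fin n)} (hg : ∀ i, g i < k ↔ i < k) :
    Commute (ρ g) (swapSum ρ k) := by
  unfold swapSum Commute SemiconjBy
  rw [Finset.mul_sum, Finset.sum_mul]
  refine Finset.sum_equiv g (fun i => by simp [hg]) fun i _ => ?_
  rw [Finset.mul_sum, Finset.sum_mul]
  refine Finset.sum_equiv g (fun j => by simp [hg]) fun j _ => ?_
  rw [← map_mul, ← map_mul, mul_swap_eq_swap_mul]

theorem sum_swap_mul_jm_mul_swap {k l : Fin n} (hkl : (l : ℕ) + 1 = k) :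
    ∑ i ∈ Finset.Iio k, ρ (swap i l) * jm ρ l * ρ (swap i l) = swapSum ρ k :=
  Finset.sum_congr rfl fun _ hi => swap_mul_jm_mul_swap_eq_sum ρ hkl (Finset.mem_Iio.1 hi)

theorem swapSum_eq (k : Fin n) : swapSum ρ k = 2 * ∑ j ∈ Finset.Iio k, jm ρ j := by
  unfold swapSum
  have h1 : ∀ i ∈ Finset.Iio k, ∑ j ∈ (Finset.Iio k).erase i, ρ (swap j i) =
      jm ρ i + ∑ j ∈ Finset.Ioo i k, ρ (swap i j) := by
    intro i hi
    rw [Finset.mem_Iio] at hi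
    have : (Finset.Iio k).erase i = Finset.Iio i ∪ Finset.Ioo i k := by
      ext j
      simp only [Finset.mem_erase, Finset.mem_Iio, Finset.mem_union, Finset.mem_Ioo]
      omega
    rw [this, Finset.sum_union]
    · refine congrArg₂ _ rfl (Finset.sum_congr rfl fun j _ => by rw [swap_comm])
    · rw [Finset.disjoint_left]
      intro j h1 h2
      rw [Finset.mem_Iio] at h1
      rw [Finset.mem_Ioo] at h2
      exact lt_asymm h1 h2.1
  rw [Finset.sum_congr rfl h1, Finset.sum_add_distrib, two_mul]
  congr 1
  unfold jm
  refine Finset.sum_comm' fun i j => ?_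
  simp only [Finset.mem_Iio, Finset.mem_Ioo]
  omega

theorem swap_mul_swap_mul_swap_of_lt {k l i : Fin n} (hkl : (l : ℕ) + 1 = k) (hi : i < k) :
    swap i l * swap l k * swap i l = swap i k := by
  rw [mul_swap_eq_swap_mul (swap i l) l k, swap_apply_right,
    swap_apply_of_ne_of_ne (by omega) (by omega), mul_assoc, swap_mul_self, mul_one]

theorem sum_swap_mul_swap_mul_swap {k l : Fin n} (hkl : (l : ℕ) + 1 = k) :
    ∑ i ∈ Finset.Iio k, ρ (swap i l) * ρ (swap l k) * ρ (swap i l) = jm ρ k := by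
  refine Finset.sum_congr rfl fun i hi => ?_
  rw [← map_mul, ← map_mul, swap_mul_swap_mul_swap_of_lt hkl (Finset.mem_Iio.1 hi)]

theorem sum_swap_mul_swap_mul_jm_mul_swap {k l : Fin n} (hkl : (l : ℕ) + 1 = k) :
    ∑ i ∈ Finset.Iio k, ρ (swap i l) * ρ (swap l k) * jm ρ l * ρ (swap i l) =
      jm ρ k ^ 2 - (k : ℕ) := by
  have h1 : ∀ i ∈ Finset.Iio k, ρ (swap i l) * ρ (swap l k) * jm ρ l * ρ (swap i l) =
      ∑ j ∈ (Finset.Iio k).erase i, ρ (swap j k * swap i k) := by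
    intro i hi
    rw [Finset.mem_Iio] at hi
    have : ρ (swap i l) * ρ (swap l k) * jm ρ l * ρ (swap i l) =
        ρ (swap i k) * (ρ (swap i l) * jm ρ l * ρ (swap i l)) := by
      rw [← swap_mul_swap_mul_swap_of_lt hkl hi, map_mul, map_mul]
      have h2 : ρ (swap i l) * ρ (swap i l) = 1 := by rw [← map_mul, swap_mul_self, map_one]
      simp only [mul_assoc]
      rw [← mul_assoc (ρ (swap i l)) (ρ (swap i l)), h2, one_mul]
    rw [this, swap_mul_jm_mul_swap_eq_sum ρ hkl hi, Finset.mul_sum]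
    refine Finset.sum_congr rfl fun j hj => ?_
    rw [Finset.mem_erase, Finset.mem_Iio] at hj
    rw [← map_mul, mul_swap_eq_swap_mul (swap i k) j i, swap_apply_left,
      swap_apply_of_ne_of_ne hj.1 hj.2.ne]
  have h2 : jm ρ k ^ 2 = ∑ i ∈ Finset.Iio k,
      (1 + ∑ j ∈ (Finset.Iio k).erase i, ρ (swap j k * swap i k)) := by
    rw [sq]
    nth_rewrite 2 [jm]
    rw [Finset.mul_sum]
    refine Finset.sum_congr rfl fun i hi => ?_
    unfold jm
    rw [Finset.sum_mul, ← Finset.add_sum_erase _ _ hi, ← map_mul, swap_mul_self, map_one]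
    simp only [map_mul]
  rw [Finset.sum_congr rfl h1, h2, Finset.sum_add_distrib]
  simp

variable {E : Type*} [AddCommGroup E] [Module ℝ E]

theorem cycleClassSum_pred_apply (ρ : Perm (Fin n) →* Module.End ℝ E) {m : ℕ} {k l : Fin n}
    (hl : (l : ℕ) = m + 1) (hk : (k : ℕ) = m + 2) (hn : n = m + 3) {α β γ t c : ℝ} {x : E}
    (hγ : cycleSum ρ (m + 1) x = γ • x) (ht : swapSum ρ k x = t • x)
    (hc : jm ρ k x = c • x)
    (hlin : ∀ i < k, cycleSum ρ m (ρ (swap i l) x) =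
      α • jm ρ l (ρ (swap i l) x) + β • ρ (swap i l) x) :
    cycleClassSum ρ (n - 1) x =
      (γ + c * (α * t + β * (m + 1)) - α * (c ^ 2 - (m + 2))) • x := by
  have hkl : (l : ℕ) + 1 = k := by omega
  have hterm : ∀ i < k, ρ (swap i k) * cycleSum ρ (m + 1) * ρ (swap i k) =
      jm ρ k * (ρ (swap i l) * cycleSum ρ m * ρ (swap i l)) -
        ρ (swap i l) * ρ (swap l k) * cycleSum ρ m * ρ (swap i l) := by
    intro i hi
    have ci : Commute (ρ (swap i l)) (cycleSum ρ (m + 1)) := commute_cycleSum ρ fun x => by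
      rw [swap_apply_def]; split_ifs with h1 h2 <;> simp_all <;> omega
    have cs : Commute (ρ (swap l k)) (cycleSum ρ m) := commute_cycleSum ρ fun x => by
      rw [swap_apply_def]; split_ifs with h1 h2 <;> simp_all
    have ck : Commute (ρ (swap i l)) (jm ρ k) := commute_jm ρ
      (swap_apply_of_ne_of_ne (by omega) (by omega)) fun x => by
        rw [swap_apply_def]; split_ifs with h1 h2 <;> omega
    have h2 : ρ (swap i l) * ρ (swap i l) = 1 := by rw [← map_mul, swap_mul_self, map_one]
    have h3 : ρ (swap i k) = ρ (swap i l) * ρ (swap l k) * ρ (swap i l) := by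
      rw [← map_mul, ← map_mul, swap_mul_swap_mul_swap_of_lt hkl hi]
    have h4 := swap_mul_jm_mul_swap ρ hkl
    generalize ρ (swap i l) = τ at *
    generalize ρ (swap l k) = s at *
    calc _ = τ * s * (τ * cycleSum ρ (m + 1)) * τ * s * τ := by rw [h3]; simp only [mul_assoc]
      _ = τ * s * cycleSum ρ (m + 1) * (τ * τ) * s * τ := by rw [ci.eq]; simp only [mul_assoc]
      _ = τ * s * jm ρ l * (cycleSum ρ m * s) * τ := by
        rw [h2, cycleSum_succ ρ hl]; simp only [mul_assoc, one_mul]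
      _ = τ * (s * jm ρ l * s) * cycleSum ρ m * τ := by rw [← cs.eq]; simp only [mul_assoc]
      _ = (τ * jm ρ k) * cycleSum ρ m * τ - τ * s * cycleSum ρ m * τ := by
        rw [h4, mul_sub, sub_mul, sub_mul]
      _ = _ := by rw [ck.eq]; simp only [mul_assoc]
  have huniv : (Finset.univ : Finset (Fin n)) = insert k (Finset.Iio k) := by
    ext i; rw [Finset.mem_insert, Finset.mem_Iio]; simp; omega
  have A1 := congrArg (fun f : Module.End ℝ E => f x) (sum_swap_mul_jm_mul_swap ρ hkl)
  have A2 := congrArg (fun f : Module.End ℝ E => f x) (sum_swap_mul_swap_mul_swap ρ hkl)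
  have A3 := congrArg (fun f : Module.End ℝ E => f x) (sum_swap_mul_swap_mul_jm_mul_swap ρ hkl)
  simp only [ht, LinearMap.sub_apply, sq, Module.End.mul_apply, hc,
    map_smul, LinearMap.sum_apply, Module.End.natCast_apply] at A1 A2 A3
  have hself : ∀ i, ρ (swap i l) (ρ (swap i l) x) = x := fun i => by
    rw [← Module.End.mul_apply, ← map_mul, swap_mul_self, map_one, Module.End.one_apply]
  rw [cycleClassSum_pred ρ hk hn, huniv, Finset.sum_insert (by simp), swap_self,
    Finset.sum_congr rfl fun i hi => hterm i (Finset.mem_Iio.1 hi), LinearMap.add_apply]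
  have hrefl : ρ (Equiv.refl _) = 1 := map_one ρ
  rw [hrefl, one_mul, mul_one, hγ, LinearMap.sum_apply]
  have hx : ∀ i ∈ Finset.Iio k, (jm ρ k * (ρ (swap i l) * cycleSum ρ m * ρ (swap i l)) -
        ρ (swap i l) * ρ (swap l k) * cycleSum ρ m * ρ (swap i l)) x =
      α • jm ρ k (ρ (swap i l) (jm ρ l (ρ (swap i l) x))) + (β * c) • x -
      (α • ρ (swap i l) (ρ (swap l k) (jm ρ l (ρ (swap i l) x))) +
        β • ρ (swap i l) (ρ (swap l k) (ρ (swap i l) x))) := by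
    intro i hi
    simp only [LinearMap.sub_apply, Module.End.mul_apply, hlin i (Finset.mem_Iio.1 hi), map_add,
      map_smul, hself, hc, smul_smul]
  rw [Finset.sum_congr rfl hx]
  simp only [Finset.sum_sub_distrib, Finset.sum_add_distrib, ← Finset.smul_sum, ← map_sum, A1, A2,
    A3, map_smul, hc, Finset.sum_const, Fin.card_Iio, hk]
  match_scalars
  ring

end NearFullCycles

section RegularRepresentation

open scoped InnerProductSpace

/-- The left regular representation of a finite group on its Euclidean space of functions. -/
noncomputable def regularRep (G : Type*) [Group G] [Fintype G] :
    G →* Module.End ℝ (EuclideanSpace ℝ G) where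
  toFun g :=
    { toFun := fun f => WithLp.toLp 2 fun u => f (g⁻¹ * u)
      map_add' := fun f f' => by ext; simp
      map_smul' := fun c f => by ext; simp }
  map_one' := by ext; simp
  map_mul' g h := by
    ext f u
    simp [mul_assoc]

variable {G : Type*} [Group G] [Fintype G]

@[simp]
theorem regularRep_apply (g : G) (f : EuclideanSpace ℝ G) (u : G) :
    regularRep G g f u = f (g⁻¹ * u) := rfl

theorem inner_regularRep_left (g : G) (x y : EuclideanSpace ℝ G) :
    ⟪regularRep G g x, y⟫_ℝ = ⟪x, regularRep G g⁻¹ y⟫_ℝ := by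
  simp only [PiLp.inner_apply, regularRep_apply, inv_inv]
  exact Fintype.sum_equiv (Equiv.mulLeft g⁻¹) _ _ fun u => by simp

theorem isSymmetric_sum_regularRep {s : Finset G} (hs : ∀ g ∈ s, g⁻¹ ∈ s) :
    (∑ g ∈ s, regularRep G g).IsSymmetric := by
  intro x y
  simp only [LinearMap.sum_apply, sum_inner, inner_sum]
  exact Finset.sum_bij' (fun g _ => g⁻¹) (fun g _ => g⁻¹) hs hs (by simp) (by simp)
    fun g _ => inner_regularRep_left g x y

variable {n : ℕ}

theorem isSymmetric_jm (k : Fin n) : (jm (regularRep (Perm (Fin n))) k).IsSymmetric := by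
  intro x y
  simp only [jm, LinearMap.sum_apply, sum_inner, inner_sum, inner_regularRep_left, swap_inv]

theorem isSymmetric_cycleSum (m : ℕ) :
    (cycleSum (regularRep (Perm (Fin n))) m).IsSymmetric := by
  classical
  refine isSymmetric_sum_regularRep fun g hg => ?_
  simp only [Finset.mem_filter, Finset.mem_univ, true_and] at hg ⊢
  refine ⟨fun j hj => ?_, fun x y hx hy => Perm.sameCycle_inv.2 (hg.2 x y hx hy)⟩
  rw [Perm.inv_eq_iff_eq, hg.1 j hj]

theorem isSymmetric_cycleClassSum (k : ℕ) :
    (cycleClassSum (regularRep (Perm (Fin n))) k).IsSymmetric := by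
  classical
  refine isSymmetric_sum_regularRep fun g hg => ?_
  simp only [Finset.mem_filter, Finset.mem_univ, true_and] at hg ⊢
  exact ⟨hg.1.inv, by rw [Perm.support_inv, hg.2]⟩

/-- `v` is a common eigenvector of all Jucys–Murphy elements, with eigenvalues `c`. -/
def IsJointEigenvector (v : EuclideanSpace ℝ (Perm (Fin n))) (c : ℕ → ℝ) : Prop :=
  v ≠ 0 ∧ ∀ k : Fin n, jm (regularRep _) k v = c k • v

theorem exists_isJointEigenvector_inner_ne_zero {x : EuclideanSpace ℝ (Perm (Fin n))}
    (hx : x ≠ 0) : ∃ v c, IsJointEigenvector v c ∧ ⟪v, x⟫_ℝ ≠ 0 := by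
  by_contra! h
  have htop := LinearMap.IsSymmetric.iSup_iInf_eq_top_of_commute
    (T := fun k : Fin n => jm (regularRep (Perm (Fin n))) k) isSymmetric_jm
    fun i j _ => jm_commute_jm _ i j
  refine hx ((Submodule.mem_bot ℝ).1 ?_)
  rw [← Submodule.top_orthogonal_eq_bot, ← htop, Submodule.mem_orthogonal]
  intro u hu
  induction hu using Submodule.iSup_induction' with
  | mem χ v hv =>
    by_cases hv0 : v = 0
    · simp [hv0]
    refine h v (fun i => if hi : i < n then χ ⟨i, hi⟩ else 0) ⟨hv0, fun k => ?_⟩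
    simpa using Module.End.mem_eigenspace_iff.1 ((Submodule.mem_iInf _).1 hv k)
  | zero => simp
  | add a b _ _ ha hb => rw [inner_add_left, ha, hb, add_zero]

theorem eq_of_inner_ne_zero {E : Type*} [NormedAddCommGroup E] [InnerProductSpace ℝ E]
    {T : Module.End ℝ E} (hT : T.IsSymmetric) {u x : E} {a b : ℝ} (hu : T u = a • u)
    (hx : T x = b • x) (h : ⟪u, x⟫_ℝ ≠ 0) : a = b := by
  have := hT u x
  rw [hu, hx, inner_smul_left, inner_smul_right] at this
  exact mul_right_cancel₀ h this

section Adjacent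

variable {v : EuclideanSpace ℝ (Perm (Fin n))} {c : ℕ → ℝ} {k l : Fin n}

theorem jm_swap_apply_left (hv : IsJointEigenvector v c) (hkl : (k : ℕ) + 1 = l) :
    jm (regularRep _) k (regularRep _ (swap k l) v) = c l • regularRep _ (swap k l) v - v := by
  have h := congrArg (fun f : Module.End ℝ _ => regularRep _ (swap k l) (f v))
    (swap_mul_jm_mul_swap (regularRep (Perm (Fin n))) hkl)
  have h2 : ∀ x, regularRep _ (swap k l) (regularRep _ (swap k l) x) = x := fun x => by
    rw [← Module.End.mul_apply, ← map_mul, swap_mul_self, map_one, Module.End.one_apply]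
  simpa only [Module.End.mul_apply, LinearMap.sub_apply, map_sub, hv.2 l, map_smul, h2] using h

theorem jm_swap_apply_right (hv : IsJointEigenvector v c) (hkl : (k : ℕ) + 1 = l) :
    jm (regularRep _) l (regularRep _ (swap k l) v) = c k • regularRep _ (swap k l) v + v := by
  have h := congrArg (fun f : Module.End ℝ _ => f (regularRep _ (swap k l) v))
    (swap_mul_jm_mul_swap (regularRep (Perm (Fin n))) hkl)
  have h2 : ∀ x, regularRep _ (swap k l) (regularRep _ (swap k l) x) = x := fun x => by
    rw [← Module.End.mul_apply, ← map_mul, swap_mul_self, map_one, Module.End.one_apply]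
  simp only [Module.End.mul_apply, LinearMap.sub_apply, h2, hv.2 k, map_smul] at h
  rw [h]; abel

theorem norm_swap_sub_sq (hv : IsJointEigenvector v c) (hkl : (k : ℕ) + 1 = l) :
    ‖regularRep _ (swap k l) v - (c l - c k) • v‖ ^ 2 = ((c l - c k) ^ 2 - 1) * ‖v‖ ^ 2 := by
  have h1 := isSymmetric_jm k (regularRep _ (swap k l) v) v
  rw [jm_swap_apply_left hv hkl, hv.2 k, inner_sub_left, inner_smul_left, inner_smul_right,
    real_inner_self_eq_norm_sq] at h1
  have h2 : ‖regularRep _ (swap k l) v‖ ^ 2 = ‖v‖ ^ 2 := by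
    rw [← real_inner_self_eq_norm_sq, inner_regularRep_left, ← Module.End.mul_apply, ← map_mul,
      inv_mul_cancel, map_one, Module.End.one_apply, real_inner_self_eq_norm_sq]
  rw [norm_sub_sq_real, h2, inner_smul_right, norm_smul, mul_pow, Real.norm_eq_abs, sq_abs]
  simp only [conj_trivial] at h1
  linear_combination (-2) * h1

theorem one_le_abs_sub (hv : IsJointEigenvector v c) (hkl : (k : ℕ) + 1 = l) :
    1 ≤ |c l - c k| := by
  have h := norm_swap_sub_sq hv hkl
  have hpos : 0 < ‖v‖ ^ 2 := by have := norm_pos_iff.2 hv.1; positivity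
  by_contra! hlt
  have h1 : (c l - c k) ^ 2 < 1 := by
    rw [← sq_abs]; nlinarith [abs_nonneg (c l - c k)]
  nlinarith [sq_nonneg ‖regularRep _ (swap k l) v - (c l - c k) • v‖,
    mul_pos (sub_pos.2 h1) hpos]

theorem swap_apply_of_abs_eq_one (hv : IsJointEigenvector v c) (hkl : (k : ℕ) + 1 = l)
    (h1 : |c l - c k| = 1) : regularRep _ (swap k l) v = (c l - c k) • v := by
  have h := norm_swap_sub_sq hv hkl
  rw [← sq_abs (c l - c k), h1, one_pow, sub_self, zero_mul, sq_eq_zero_iff, norm_eq_zero] at h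
  exact sub_eq_zero.1 h

theorem isJointEigenvector_swap (hv : IsJointEigenvector v c) (hkl : (k : ℕ) + 1 = l)
    (h1 : 1 < |c l - c k|) :
    IsJointEigenvector ((c l - c k) • regularRep _ (swap k l) v - v)
      (c ∘ swap (k : ℕ) (k + 1)) := by
  refine ⟨fun h0 => ?_, fun j => ?_⟩
  · have h2 := congrArg (regularRep _ (swap k l)) (sub_eq_zero.1 h0)
    rw [map_smul, ← Module.End.mul_apply, ← map_mul, swap_mul_self, map_one,
      Module.End.one_apply] at h2
    have h3 := norm_swap_sub_sq hv hkl
    rw [← h2, sub_self, norm_zero, zero_pow two_ne_zero, ← sq_abs (c l - c k)] at h3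
    have hpos : 0 < ‖v‖ ^ 2 := by have := norm_pos_iff.2 hv.1; positivity
    have h4 : 0 < |c l - c k| ^ 2 - 1 := by nlinarith
    have := mul_pos h4 hpos
    linarith
  · rw [map_sub, map_smul, hv.2 j, Function.comp_apply, hkl]
    by_cases hjk : j = k
    · subst hjk
      rw [swap_apply_left, jm_swap_apply_left hv hkl]
      match_scalars <;> ring
    by_cases hjl : j = l
    · subst hjl
      rw [swap_apply_right, jm_swap_apply_right hv hkl]
      match_scalars <;> ring
    · rw [swap_apply_of_ne_of_ne (by omega) (by omega), smul_sub]
      have := commute_jm (regularRep (Perm (Fin n))) (k := j) (g := swap k l)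
        (swap_apply_of_ne_of_ne hjk hjl) fun i => by
          rw [swap_apply_def]; split_ifs with h1 h2 <;> omega
      rw [← Module.End.mul_apply, ← this.eq, Module.End.mul_apply, hv.2 j, map_smul, smul_comm]

end Adjacent

theorem swap_braid {α : Type*} [DecidableEq α] {a b c : α} (hab : a ≠ b) (hbc : b ≠ c)
    (hac : a ≠ c) : swap a b * swap b c * swap a b = swap b c * swap a b * swap b c := by
  rw [swap_mul_swap_mul_swap hab hac, swap_comm a b, swap_comm b c,
    swap_mul_swap_mul_swap hbc.symm hac.symm, swap_comm]

theorem admissibleSpectra (hn : 0 < n) :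
    AdmissibleSpectra n {c | ∃ v : EuclideanSpace ℝ (Perm (Fin n)), IsJointEigenvector v c} where
  zero := by
    rintro c ⟨v, hv⟩
    have h := hv.2 ⟨0, hn⟩
    have h0 : jm (regularRep (Perm (Fin n))) ⟨0, hn⟩ = 0 := by
      refine Finset.sum_eq_zero fun i hi => ?_
      rw [Finset.mem_Iio, Fin.lt_def] at hi
      exact absurd hi (Nat.not_lt_zero _)
    rw [h0, LinearMap.zero_apply] at h
    exact (smul_eq_zero.1 h.symm).resolve_right hv.1
  one_le := by
    rintro c ⟨v, hv⟩ i hi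
    exact one_le_abs_sub hv (k := ⟨i, by omega⟩) (l := ⟨i + 1, hi⟩) rfl
  swap := by
    rintro c ⟨v, hv⟩ i hi h
    exact ⟨_, isJointEigenvector_swap hv (k := ⟨i, by omega⟩) (l := ⟨i + 1, hi⟩) rfl h⟩
  no_triple := by
    rintro c ⟨v, hv⟩ i hi h h'
    have h1 := swap_apply_of_abs_eq_one hv (k := ⟨i, by omega⟩) (l := ⟨i + 1, by omega⟩) rfl h
    have h2 := swap_apply_of_abs_eq_one hv (k := ⟨i + 1, by omega⟩) (l := ⟨i + 2, hi⟩) rfl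
      (by rw [← h, ← abs_neg]; simp [h'])
    have hb := swap_braid (a := (⟨i, by omega⟩ : Fin n)) (b := ⟨i + 1, by omega⟩)
      (c := ⟨i + 2, hi⟩) (by simp) (by simp) (by simp)
    have h3 := congrArg (fun g => regularRep (Perm (Fin n)) g v) hb
    simp only [map_mul, Module.End.mul_apply, h1, h2, map_smul, smul_smul, h'] at h3
    rw [← sub_eq_zero, ← sub_smul, smul_eq_zero, or_iff_left hv.1] at h3
    have h4 : (c (i + 1) - c i) ^ 2 = 1 := by rw [← sq_abs, h, one_pow]
    have h5 : c (i + 1) - c i = 0 := by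
      linear_combination (-1 / 2) * h3 - (c (i + 1) - c i) * h4
    rw [h5] at h4
    norm_num at h4

end RegularRepresentation

section HookVectors

open scoped InnerProductSpace

variable {n : ℕ} {v : EuclideanSpace ℝ (Perm (Fin n))} {c : ℕ → ℝ} {m p q : ℕ}

/-- `v` is supported on permutations of the points `0, …, m`. -/
def SupportedOn (m : ℕ) (v : EuclideanSpace ℝ (Perm (Fin n))) : Prop :=
  ∀ g, v g ≠ 0 → ∀ j : Fin n, m < j → g j = j

theorem inner_regularRep_eq_zero (hv : SupportedOn m v) {k : Fin n} (hk : m < k)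
    {σ : Perm (Fin n)} (hσ : σ k ≠ k) : ⟪v, regularRep _ σ v⟫_ℝ = 0 := by
  rw [PiLp.inner_apply]
  refine Finset.sum_eq_zero fun u _ => ?_
  rw [regularRep_apply]
  by_contra h
  have h1 : v u ≠ 0 := fun h0 => h (by simp [h0])
  have h2 : v (σ⁻¹ * u) ≠ 0 := fun h0 => h (by simp [h0])
  have h3 := hv _ h2 k hk
  rw [Perm.mul_apply, hv _ h1 k hk, Perm.inv_eq_iff_eq] at h3
  exact hσ h3.symm

theorem inner_jm_eq_zero (hv : SupportedOn m v) {k : Fin n} (hk : m < k) :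
    ⟪v, jm (regularRep _) k v⟫_ℝ = 0 := by
  rw [jm, LinearMap.sum_apply, inner_sum]
  refine Finset.sum_eq_zero fun i hi => inner_regularRep_eq_zero hv hk ?_
  rw [swap_apply_right]
  exact (Finset.mem_Iio.1 hi).ne

theorem inner_jm_jm (hv : SupportedOn m v) {k : Fin n} (hk : m < k) :
    ⟪v, jm (regularRep _) k (jm (regularRep _) k v)⟫_ℝ = k * ⟪v, v⟫_ℝ := by
  simp only [jm, LinearMap.sum_apply, map_sum, inner_sum]
  have h : ∀ i ∈ Finset.Iio k, ∑ j ∈ Finset.Iio k,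
      ⟪v, regularRep _ (swap i k) (regularRep _ (swap j k) v)⟫_ℝ = ⟪v, v⟫_ℝ := by
    intro i hi
    rw [Finset.sum_eq_single_of_mem i hi]
    · rw [← Module.End.mul_apply, ← map_mul, swap_mul_self, map_one, Module.End.one_apply]
    · intro j hj hij
      rw [← Module.End.mul_apply, ← map_mul]
      refine inner_regularRep_eq_zero hv hk ?_
      have hjk := (Finset.mem_Iio.1 hj).ne
      rw [Perm.mul_apply, swap_apply_right, swap_apply_of_ne_of_ne hij hjk]
      exact hjk
  rw [Finset.sum_comm, Finset.sum_congr rfl h]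
  simp

theorem SupportedOn.jm (hv : SupportedOn m v) {k : Fin n} (hk : (k : ℕ) ≤ m) :
    SupportedOn m (jm (regularRep _) k v) := by
  intro g hg j hj
  have hg' : ∑ i ∈ Finset.Iio k, v ((swap i k)⁻¹ * g) ≠ 0 := by
    simpa [_root_.jm] using hg
  obtain ⟨i, hi, h⟩ := Finset.exists_ne_zero_of_sum_ne_zero hg'
  have h1 := hv _ h j hj
  rw [Perm.mul_apply, Perm.inv_eq_iff_eq] at h1
  rw [h1, swap_apply_of_ne_of_ne]
  · have := Finset.mem_Iio.1 hi; omega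
  · omega

theorem SupportedOn.sub {w : EuclideanSpace ℝ (Perm (Fin n))} (hv : SupportedOn m v)
    (hw : SupportedOn m w) : SupportedOn m (v - w) := by
  intro g hg
  by_cases h : v g = 0
  · exact hw g fun h' => hg (by simp [h, h'])
  · exact hv g h

theorem SupportedOn.add {w : EuclideanSpace ℝ (Perm (Fin n))} (hv : SupportedOn m v)
    (hw : SupportedOn m w) : SupportedOn m (v + w) := by
  intro g hg
  by_cases h : v g = 0
  · exact hw g fun h' => hg (by simp [h, h'])
  · exact hv g h

theorem SupportedOn.smul (hv : SupportedOn m v) (a : ℝ) : SupportedOn m (a • v) :=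
  fun g hg => hv g fun h => hg (by simp [h])

theorem exists_extend (hv0 : v ≠ 0) (hv : SupportedOn m v)
    (hvc : ∀ j : Fin n, (j : ℕ) ≤ m → jm (regularRep _) j v = c j • v)
    (hc : HookContents c m p q) (hm : m + 1 < n) {y y₁ y₂ : ℝ}
    (hy : ∀ x, IsNextContent x p q → x = y ∨ x = y₁ ∨ x = y₂)
    (hne : (m : ℝ) + 1 + y₁ * y₂ ≠ 0) :
    ∃ w : EuclideanSpace ℝ (Perm (Fin n)), w ≠ 0 ∧ SupportedOn (m + 1) w ∧
      ∀ j : Fin n, (j : ℕ) ≤ m + 1 →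
        jm (regularRep _) j w = Function.update c (m + 1) y j • w := by
  obtain ⟨k, hk⟩ : ∃ k : Fin n, (k : ℕ) = m + 1 := ⟨⟨m + 1, hm⟩, rfl⟩
  set J := jm (regularRep (Perm (Fin n))) k with hJ
  have hw : ∃ w, w = J (J v) - (y₁ + y₂) • J v + (y₁ * y₂) • v := ⟨_, rfl⟩
  obtain ⟨w, hw⟩ := hw
  have hinner : ⟪v, w⟫_ℝ = (m + 1 + y₁ * y₂) * ⟪v, v⟫_ℝ := by
    rw [hw, inner_add_right, inner_sub_right, inner_jm_jm hv (by omega), inner_smul_right,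
      inner_smul_right, inner_jm_eq_zero hv (by omega), hk]
    push_cast; ring
  have hJw : J w = y • w := by
    by_contra h
    obtain ⟨u, e, hu, hin⟩ := exists_isJointEigenvector_inner_ne_zero (sub_ne_zero.2 h)
    have hs : ∀ x, ⟪u, J x⟫_ℝ = e k * ⟪u, x⟫_ℝ := fun x => by
      rw [← isSymmetric_jm k u x, hu.2 k, inner_smul_left]; rfl
    have h1 : ⟪u, J w - y • w⟫_ℝ = (e k - y) * ((e k - y₁) * (e k - y₂)) * ⟪u, v⟫_ℝ := by
      rw [inner_sub_right, hs, inner_smul_right, hw, inner_add_right, inner_sub_right,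
        inner_smul_right, inner_smul_right, hs, hs]
      ring
    rw [h1] at hin
    have huv := right_ne_zero_of_mul hin
    refine left_ne_zero_of_mul hin ?_
    have he : HookContents e m p q := hc.congr fun i hi =>
      eq_of_inner_ne_zero (isSymmetric_jm (⟨i, by omega⟩ : Fin n)) (hu.2 _) (hvc _ hi) huv
    have hnext := (admissibleSpectra (by omega)).isNextContent m e ⟨u, hu⟩ p q he hm
    rw [← hk] at hnext
    rcases hy _ hnext with h | h | h <;> rw [h] <;> simp
  have hv' : SupportedOn (m + 1) v := fun g hg j hj => hv g hg j (by omega)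
  refine ⟨w, fun h0 => ?_, ?_, fun j hj => ?_⟩
  · rw [h0, inner_zero_right] at hinner
    exact mul_ne_zero hne (inner_self_ne_zero.2 hv0) hinner.symm
  · rw [hw]
    exact (((hv'.jm hk.le).jm hk.le).sub ((hv'.jm hk.le).smul _)).add (hv'.smul _)
  · rcases hj.lt_or_eq with hj | hj
    · rw [Function.update_of_ne (by omega)]
      have hcomm : ∀ x, jm (regularRep _) j (J x) = J (jm (regularRep _) j x) := fun x =>
        LinearMap.congr_fun (jm_commute_jm (regularRep (Perm (Fin n))) j k).eq x
      have hjv := hvc j (by omega)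
      rw [hw]
      simp only [map_add, map_sub, map_smul, hcomm, hjv]
      module
    · obtain rfl : j = k := by omega
      rw [hj, Function.update_self, hJw]

theorem exists_hookVector (p q : ℕ) (h : p + q < n) :
    ∃ (v : EuclideanSpace ℝ (Perm (Fin n))) (c : ℕ → ℝ), v ≠ 0 ∧ SupportedOn (p + q) v ∧
      (∀ j : Fin n, (j : ℕ) ≤ p + q → jm (regularRep _) j v = c j • v) ∧
      HookContents c (p + q) p q := by
  induction p with
  | zero =>
    rw [zero_add] at h ⊢
    induction q with
    | zero =>
      refine ⟨EuclideanSpace.single 1 1, 0, by simp, fun g hg j hj => ?_, fun j hj => ?_,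
        .zero rfl⟩
      · have : g = 1 := by
          by_contra h1
          exact hg (by simp [h1])
        rw [this, Perm.one_apply]
      · have : Finset.Iio j = ∅ := by
          ext i; simp only [Finset.mem_Iio, Finset.notMem_empty, iff_false]; omega
        simp [jm, this]
    | succ q ih =>
      obtain ⟨v, c, h0, h1, h2, h3⟩ := ih (by omega)
      obtain ⟨w, hw0, hw1, hw2⟩ := exists_extend (y := -(q + 1)) (y₁ := (0 : ℕ) + 1) (y₂ := 0)
        h0 h1 h2 h3 h (fun x hx => by rcases hx with hx | hx | ⟨hx, -⟩ <;> simp [hx])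
        (by rw [mul_zero, add_zero]; positivity)
      exact ⟨w, _, hw0, hw1, hw2, .leg (h3.congr fun i hi => by
        rw [Function.update_of_ne (by omega)]) (by rw [Function.update_self])⟩
  | succ p ih =>
    obtain ⟨v, c, h0, h1, h2, h3⟩ := ih (by omega)
    obtain ⟨w, hw0, hw1, hw2⟩ := exists_extend (y := p + 1) (y₁ := -(q + 1)) (y₂ := 0)
      h0 h1 h2 h3 (by omega) (fun x hx => by rcases hx with hx | hx | ⟨hx, -⟩ <;> simp [hx])
      (by rw [mul_zero, add_zero]; positivity)
    rw [show p + 1 + q = p + q + 1 by ring]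
    exact ⟨w, _, hw0, hw1, hw2, .arm (h3.congr fun i hi => by
      rw [Function.update_of_ne (by omega)]) (by rw [Function.update_self])⟩

/-- A hook vector extended by a box of content zero. -/
theorem exists_extend_hookVector (p q : ℕ) (hp : 1 ≤ p) (hq : 1 ≤ q) (h : p + q + 1 < n) :
    ∃ (v : EuclideanSpace ℝ (Perm (Fin n))) (c : ℕ → ℝ), v ≠ 0 ∧
      (∀ j : Fin n, (j : ℕ) ≤ p + q + 1 → jm (regularRep _) j v = c j • v) ∧
      HookContents c (p + q) p q ∧ c (p + q + 1) = 0 := by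
  obtain ⟨v, c, h0, h1, h2, h3⟩ := exists_hookVector p q (by omega : p + q < n)
  obtain ⟨w, hw0, -, hw2⟩ := exists_extend (y := 0) (y₁ := p + 1) (y₂ := -(q + 1))
    h0 h1 h2 h3 (by omega) (fun x hx => by rcases hx with hx | hx | ⟨hx, -⟩ <;> simp [hx])
    (by
      have : (0 : ℝ) < p * q := by positivity
      push_cast
      intro h
      nlinarith)
  exact ⟨w, _, hw0, hw2, h3.congr fun i hi => by rw [Function.update_of_ne (by omega)],
    Function.update_self _ _ _⟩

end HookVectors

section Eigenvalues

variable {n m : ℕ}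

theorem cycleSum_apply_of_jm {E : Type*} [AddCommGroup E] [Module ℝ E]
    (ρ : Perm (Fin n) →* Module.End ℝ E) {c : ℕ → ℝ} {x : E} (hm : m < n)
    (hx : ∀ j : Fin n, (j : ℕ) ≤ m → jm ρ j x = c j • x) :
    cycleSum ρ m x = (∏ i ∈ Finset.range m, c (i + 1)) • x := by
  induction m with
  | zero => simp [cycleSum_zero]
  | succ m ih =>
    rw [cycleSum_succ ρ (k := ⟨m + 1, hm⟩) rfl, Module.End.mul_apply,
      ih (by omega) fun j hj => hx j (by omega), map_smul, hx _ le_rfl, smul_smul,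
      Finset.prod_range_succ]

theorem swapSum_apply_of_jm {E : Type*} [AddCommGroup E] [Module ℝ E]
    (ρ : Perm (Fin n) →* Module.End ℝ E) {c : ℕ → ℝ} {x : E} {k : Fin n} (hk : (k : ℕ) = m + 1)
    (h0 : c 0 = 0) (hx : ∀ j : Fin n, (j : ℕ) ≤ m → jm ρ j x = c j • x) :
    swapSum ρ k x = (2 * ∑ i ∈ Finset.range m, c (i + 1)) • x := by
  have h1 : ∑ j ∈ Finset.Iio k, c j = ∑ i ∈ Finset.range m, c (i + 1) := by
    rw [← add_zero (∑ i ∈ Finset.range m, c (i + 1)), ← h0, ← Finset.sum_range_succ', ← hk,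
      ← Nat.Iio_eq_range, ← Fin.map_valEmbedding_Iio, Finset.sum_map]
    rfl
  rw [swapSum_eq, two_mul, two_mul, LinearMap.add_apply, LinearMap.sum_apply, add_smul, ← h1,
    Finset.sum_smul, Finset.sum_congr rfl fun j hj =>
      hx j (by have := Finset.mem_Iio.1 hj; omega)]

open scoped InnerProductSpace

theorem cycleSum_apply_of_hook {x : EuclideanSpace ℝ (Perm (Fin n))} {p q : ℕ} {α β γ : ℝ}
    {k l : Fin n} (hl : (l : ℕ) = m + 1) (hk : (k : ℕ) = m + 2) (hpq : p + q = m + 1)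
    (hγ0 : γ ≠ 0) (hγ : cycleSum (regularRep _) (m + 1) x = γ • x)
    (ht : swapSum (regularRep _) k x = (((p : ℝ) - q) * (p + q + 1)) • x)
    (hp : 1 ≤ p → (α * p + β) * p = γ) (hq : 1 ≤ q → (α * (-q) + β) * (-q) = γ) :
    cycleSum (regularRep _) m x = α • jm (regularRep _) l x + β • x := by
  by_contra hne
  obtain ⟨u, e, hu, hin⟩ := exists_isJointEigenvector_inner_ne_zero (sub_ne_zero.2 hne)
  have hS := admissibleSpectra (n := n) (by omega)
  have hue : e ∈ {c | ∃ v : EuclideanSpace ℝ (Perm (Fin n)), IsJointEigenvector v c} := ⟨u, hu⟩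
  have hu' : ∀ m' (j : Fin n), (j : ℕ) ≤ m' → jm (regularRep _) j u = e j • u := fun _ j _ => hu.2 j
  have h1 : ⟪u, cycleSum (regularRep _) m x - (α • jm (regularRep _) l x + β • x)⟫_ℝ =
      (∏ i ∈ Finset.range m, e (i + 1) - (α * e (m + 1) + β)) * ⟪u, x⟫_ℝ := by
    rw [inner_sub_right, inner_add_right, inner_smul_right, inner_smul_right,
      ← isSymmetric_cycleSum m u x, ← isSymmetric_jm l u x, hu.2 l,
      cycleSum_apply_of_jm _ (by omega) (hu' _), inner_smul_left, inner_smul_left, hl]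
    simp only [conj_trivial]
    ring
  rw [h1] at hin
  have hux := right_ne_zero_of_mul hin
  have hprod := eq_of_inner_ne_zero (isSymmetric_cycleSum (m + 1))
    (cycleSum_apply_of_jm _ (by omega) (hu' _)) hγ hux
  obtain ⟨p', q', hhook⟩ := hS.exists_hookContents hue (m + 1) (by omega) (hprod ▸ hγ0)
  have hsymm : (swapSum (regularRep (Perm (Fin n))) k).IsSymmetric := by
    intro a b
    rw [swapSum_eq, two_mul]
    simp only [LinearMap.add_apply, LinearMap.sum_apply, inner_add_left, inner_add_right,
      sum_inner, inner_sum, isSymmetric_jm _ a b]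
  have hsum := eq_of_inner_ne_zero hsymm
    (swapSum_apply_of_jm (m := m + 1) _ hk (hS.zero e hue) (hu' _)) ht hux
  have hadd := hhook.add_eq
  rw [hhook.sum_eq] at hsum
  have h2 : (p' : ℝ) + q' = p + q := by
    exact_mod_cast (show p' + q' = p + q by omega)
  have h3 : ((p' : ℝ) - q' - (p - q)) * (p + q + 1) = 0 := by
    rw [h2] at hsum; linear_combination hsum
  have h4 : (p : ℝ) + q + 1 ≠ 0 := by positivity
  have h5 := (mul_eq_zero.1 h3).resolve_right h4
  obtain rfl : p' = p := by
    have : (p' : ℝ) = p := by linarith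
    exact_mod_cast this
  obtain rfl : q' = q := by omega
  refine left_ne_zero_of_mul hin (sub_eq_zero.2 ?_)
  rw [Finset.prod_range_succ] at hprod
  rcases hhook.last with ⟨h, h'⟩ | ⟨h, h'⟩
  · rw [h] at hprod ⊢
    exact mul_right_cancel₀ (by positivity : (p' : ℝ) ≠ 0) (hprod.trans (hp h').symm)
  · rw [h] at hprod ⊢
    exact mul_right_cancel₀ (neg_ne_zero.2 (by positivity : (q' : ℝ) ≠ 0))
      (hprod.trans (hq h').symm)

theorem cycleClassSum_pred_apply_of_hook {x : EuclideanSpace ℝ (Perm (Fin n))} {c : ℕ → ℝ}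
    {p q : ℕ} {α β γ : ℝ} (hn : n = m + 3) (hx : ∀ j : Fin n, jm (regularRep _) j x = c j • x)
    (hc : HookContents c (m + 1) p q) (hγ : γ = (-1) ^ q * p.factorial * q.factorial)
    (hp : 1 ≤ p → (α * p + β) * p = γ) (hq : 1 ≤ q → (α * (-q) + β) * (-q) = γ) :
    cycleClassSum (regularRep _) (n - 1) x =
      (γ + c (m + 2) * (α * ((p - q) * (p + q + 1)) + β * (p + q)) -
        α * (c (m + 2) ^ 2 - (p + q + 1))) • x := by
  obtain ⟨k, hk⟩ : ∃ k : Fin n, (k : ℕ) = m + 2 := ⟨⟨m + 2, by omega⟩, rfl⟩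
  obtain ⟨l, hl⟩ : ∃ l : Fin n, (l : ℕ) = m + 1 := ⟨⟨m + 1, by omega⟩, rfl⟩
  have hpq := hc.add_eq
  have hpq' : (m : ℝ) + 1 = p + q := by exact_mod_cast hpq.symm
  have hγ0 : γ ≠ 0 := by rw [hγ]; positivity
  have h0 : c 0 = 0 := by
    clear hp hq hγ hpq hpq'
    have : ∀ m p q, HookContents c m p q → c 0 = 0 := fun m p q h => by
      induction h <;> assumption
    exact this _ _ _ hc
  have h1 : cycleSum (regularRep _) (m + 1) x = γ • x := by
    rw [cycleSum_apply_of_jm _ (by omega) fun j _ => hx j, hc.prod_eq, hγ]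
  have h2 : swapSum (regularRep _) k x = (((p : ℝ) - q) * (p + q + 1)) • x := by
    rw [swapSum_apply_of_jm (m := m + 1) _ hk h0 fun j _ => hx j, hc.sum_eq]
    congr 1; ring
  rw [cycleClassSum_pred_apply _ hl hk hn h1 h2 (hk ▸ hx k) (α := α) (β := β) ?_]
  · congr 1
    rw [show (m : ℝ) + 2 = p + q + 1 by linarith, hpq']
  · intro i hi
    refine cycleSum_apply_of_hook hl hk hpq hγ0 ?_ ?_ hp hq
    · rw [← Module.End.mul_apply, ← (commute_cycleSum (regularRep (Perm (Fin n))) fun y => ?_).eq,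
        Module.End.mul_apply, h1, map_smul]
      rw [swap_apply_def]; split_ifs with h1 h2 <;> simp_all <;> omega
    · rw [← Module.End.mul_apply, ← (commute_swapSum (regularRep (Perm (Fin n))) fun y => ?_).eq,
        Module.End.mul_apply, h2, map_smul]
      rw [swap_apply_def]; split_ifs with h1 h2 <;> omega

theorem cycleClassSum_pred_apply_of_pos {x : EuclideanSpace ℝ (Perm (Fin n))} {c : ℕ → ℝ}
    {p q : ℕ} (hn : n = m + 3) (hx : ∀ j : Fin n, jm (regularRep _) j x = c j • x)
    (hc : HookContents c (m + 1) (p + 1) (q + 1)) :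
    cycleClassSum (regularRep _) (n - 1) x = ((-1) ^ (q + 1) * p.factorial * q.factorial *
      (p + 2 - c (m + 2)) * (q + 2 + c (m + 2))) • x := by
  rw [cycleClassSum_pred_apply_of_hook (α := (-1) ^ (q + 1) * p.factorial * q.factorial)
    (β := (-1) ^ (q + 1) * p.factorial * q.factorial * (q - p)) hn hx hc rfl]
  · congr 1
    simp only [Nat.factorial_succ]
    push_cast; ring
  all_goals
    intro _
    simp only [Nat.factorial_succ]
    push_cast; ring

theorem cycleClassSum_pred_apply_of_arm {x : EuclideanSpace ℝ (Perm (Fin n))} {c : ℕ → ℝ}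
    {p : ℕ} (hn : n = m + 3) (hx : ∀ j : Fin n, jm (regularRep _) j x = c j • x)
    (hc : HookContents c (m + 1) p 0) :
    cycleClassSum (regularRep _) (n - 1) x = (p.factorial * (1 + c (m + 2))) • x := by
  obtain rfl : p = m + 1 := by simpa using hc.add_eq
  rw [cycleClassSum_pred_apply_of_hook (α := 0) (β := m.factorial) hn hx hc rfl]
  · congr 1
    simp only [Nat.factorial_succ]
    push_cast; simp; ring
  · intro _
    simp only [Nat.factorial_succ]
    push_cast; simp; ring
  · simp

theorem cycleClassSum_pred_apply_of_leg {x : EuclideanSpace ℝ (Perm (Fin n))} {c : ℕ → ℝ}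
    {q : ℕ} (hn : n = m + 3) (hx : ∀ j : Fin n, jm (regularRep _) j x = c j • x)
    (hc : HookContents c (m + 1) 0 q) :
    cycleClassSum (regularRep _) (n - 1) x =
      ((-1) ^ q * q.factorial * (1 - c (m + 2))) • x := by
  obtain rfl : q = m + 1 := by simpa using hc.add_eq
  rw [cycleClassSum_pred_apply_of_hook (α := 0) (β := -(-1) ^ (m + 1) * m.factorial) hn hx hc rfl]
  · congr 1
    simp only [Nat.factorial_succ]
    push_cast; simp; ring
  · simp
  · intro _
    simp only [Nat.factorial_succ]
    push_cast; simp; ring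

end Eigenvalues

section Bounds

open Nat

theorem factorial_mul_factorial_le (a b : ℕ) : (a + 2)! * (b + 2)! ≤ 2 * (a + b + 2)! := by
  induction b with
  | zero => simp [mul_comm]
  | succ b ih =>
    calc (a + 2)! * (b + 1 + 2)! = (b + 3) * ((a + 2)! * (b + 2)!) := by
          rw [show b + 1 + 2 = (b + 2) + 1 by ring, factorial_succ (b + 2)]; ring
      _ ≤ (a + b + 3) * (2 * (a + b + 2)!) := Nat.mul_le_mul (by omega) ih
      _ = 2 * (a + (b + 1) + 2)! := by
          rw [show a + (b + 1) + 2 = (a + b + 2) + 1 by ring, factorial_succ (a + b + 2)]; ring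

theorem factorial_mul_factorial_mul_le (a b : ℕ) :
    (a + 1)! * (b + 1)! * ((a + 3) * (b + 3)) ≤ 3 * (a + b + 3) * (a + b + 1)! := by
  induction b with
  | zero => simp; apply le_of_eq; ring
  | succ b ih =>
    have h1 : (b + 2) * (b + 4) * (a + b + 3) ≤ (a + b + 2) * (a + b + 4) * (b + 3) := by
      nlinarith [Nat.zero_le (a * (b * b)), Nat.zero_le (a * a * b), Nat.zero_le (a * b),
        Nat.zero_le (a * a)]
    refine Nat.le_of_mul_le_mul_right (c := (b + 3) * (a + b + 3)) ?_ (by positivity)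
    calc (a + 1)! * (b + 1 + 1)! * ((a + 3) * (b + 1 + 3)) * ((b + 3) * (a + b + 3))
        = (a + 1)! * (b + 1)! * ((a + 3) * (b + 3)) * ((b + 2) * (b + 4) * (a + b + 3)) := by
          rw [factorial_succ (b + 1)]; ring
      _ ≤ 3 * (a + b + 3) * (a + b + 1)! * ((a + b + 2) * (a + b + 4) * (b + 3)) :=
          Nat.mul_le_mul ih h1
      _ = 3 * (a + (b + 1) + 3) * (a + (b + 1) + 1)! * ((b + 3) * (a + b + 3)) := by
          rw [show a + (b + 1) + 1 = (a + b + 1) + 1 by ring, factorial_succ (a + b + 1)]; ring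

end Bounds

section Spectrum

open scoped InnerProductSpace
open Nat

variable {n : ℕ}

theorem prod_contents_le_of_odd (hodd : Odd n) (hn : 4 < n) {p q : ℕ} (hpq : p + q = n - 1) :
    ((-1) ^ q * p ! * q ! : ℝ) = ((n - 1)! : ℕ) ∨
      ((-1) ^ q * p ! * q ! : ℝ) ≤ ((2 * (n - 3)! : ℕ) : ℝ) := by
  rcases Nat.even_or_odd q with hq | hq
  · rw [hq.neg_one_pow, one_mul]
    match p, q, hpq, hq with
    | 0, q, hpq, hq => left; simp [← hpq]
    | p, 0, hpq, hq => left; simp [← hpq]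
    | 1, q, hpq, hq => exfalso; grind
    | p, 1, hpq, hq => exact absurd hq (by decide)
    | a + 2, b + 2, hpq, hq =>
      right
      rw [show n - 3 = a + b + 2 by omega]
      exact_mod_cast factorial_mul_factorial_le a b
  · right
    rw [hq.neg_one_pow]
    have : (0 : ℝ) ≤ p ! * q ! := by positivity
    have : (0 : ℝ) ≤ ((2 * (n - 3)! : ℕ) : ℝ) := by positivity
    linarith

theorem eigenvalues_cycleClassSum_of_odd (hodd : Odd n) (hn : 4 < n) {μ : ℝ}
    (hμ : Module.End.HasEigenvalue (cycleClassSum (regularRep (Perm (Fin n))) n) μ) :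
    μ = ((n - 1)! : ℕ) ∨ μ ≤ ((2 * (n - 3)! : ℕ) : ℝ) := by
  obtain ⟨v, hv⟩ := hμ.exists_hasEigenvector
  obtain ⟨u, e, hu, hin⟩ := exists_isJointEigenvector_inner_ne_zero hv.2
  have h1 := hv.apply_eq_smul
  rw [cycleClassSum_self _ (by omega)] at h1
  have h2 := eq_of_inner_ne_zero (isSymmetric_cycleSum (n - 1))
    (cycleSum_apply_of_jm _ (by omega) fun j _ => hu.2 j) h1 hin
  by_cases h0 : μ = 0
  · right; rw [h0]; positivity
  obtain ⟨p, q, h⟩ := (admissibleSpectra (n := n) (by omega)).exists_hookContents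
    ⟨u, hu⟩ (n - 1) (by omega) (h2 ▸ h0)
  rw [← h2, h.prod_eq]
  exact prod_contents_le_of_odd hodd hn h.add_eq

theorem hasEigenvalue_cycleClassSum_of_add_eq {p q : ℕ} (hn : 2 ≤ n) (hpq : p + q = n - 1) :
    Module.End.HasEigenvalue (cycleClassSum (regularRep (Perm (Fin n))) n)
      ((-1) ^ q * p ! * q !) := by
  obtain ⟨v, c, h0, -, h2, h3⟩ := exists_hookVector (n := n) p q (by omega)
  refine Module.End.hasEigenvalue_of_hasEigenvector (x := v)
    ⟨Module.End.mem_eigenspace_iff.2 ?_, h0⟩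
  rw [cycleClassSum_self _ hn, ← h3.prod_eq, ← hpq]
  exact cycleSum_apply_of_jm _ (by omega) h2

theorem nextContent_value_le {p q : ℕ} {c : ℝ} (hc : c = p + 2 ∨ c = -(q + 2) ∨ c = 0)
    (heven : Even n) (hn : 5 < n) (hpq : p + 1 + (q + 1) = n - 2) :
    (-1) ^ (q + 1) * p ! * q ! * (p + 2 - c) * (q + 2 + c) ≤
      ((3 * (n - 3) * (n - 5)! : ℕ) : ℝ) := by
  rcases hc with rfl | rfl | rfl
  · rw [sub_self, mul_zero, zero_mul]; positivity
  · rw [add_neg_cancel, mul_zero]; positivity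
  rw [sub_zero, add_zero]
  rcases Nat.even_or_odd (q + 1) with hq | hq
  · rw [hq.neg_one_pow, one_mul]
    match p, q, hpq, hq with
    | 0, q, hpq, hq => exfalso; grind
    | p, 0, hpq, hq => exact absurd hq (by decide)
    | a + 1, b + 1, hpq, hq =>
      rw [show n - 3 = a + b + 3 by omega, show n - 5 = a + b + 1 by omega]
      have := factorial_mul_factorial_mul_le a b
      have h : ((((a + 1)! * (b + 1)! * ((a + 3) * (b + 3)) : ℕ)) : ℝ) ≤
        ((3 * (a + b + 3) * (a + b + 1)! : ℕ) : ℝ) := by exact_mod_cast this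
      refine le_trans (le_of_eq ?_) h
      push_cast; ring
  · rw [hq.neg_one_pow]
    have : (0 : ℝ) ≤ p ! * q ! * (p + 2) * (q + 2) := by positivity
    have : (0 : ℝ) ≤ ((3 * (n - 3) * (n - 5)! : ℕ) : ℝ) := by positivity
    linarith

theorem eigenvalues_cycleClassSum_pred_of_hook (heven : Even n) (hn : 5 < n)
    {u : EuclideanSpace ℝ (Perm (Fin n))} {c : ℕ → ℝ} (hu : IsJointEigenvector u c) {p q : ℕ}
    (h : HookContents c (n - 2) p q) :
    ∃ μ : ℝ, cycleClassSum (regularRep (Perm (Fin n))) (n - 1) u = μ • u ∧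
      (μ = ((n * (n - 2)! : ℕ) : ℝ) ∨ μ ≤ ((3 * (n - 3) * (n - 5)! : ℕ) : ℝ)) := by
  obtain ⟨m, rfl⟩ : ∃ m, n = m + 3 := ⟨n - 3, by omega⟩
  rw [show m + 3 - 2 = m + 1 by omega] at h ⊢
  have hnext := (admissibleSpectra (n := m + 3) (by omega)).isNextContent (m + 1) c ⟨u, hu⟩ p q h
    (by omega)
  have hpq := h.add_eq
  match p, q, h, hnext, hpq with
  | 0, q, h, hnext, hpq =>
    refine ⟨_, cycleClassSum_pred_apply_of_leg rfl hu.2 h, ?_⟩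
    obtain rfl : q = m + 1 := by omega
    have hev : Even (m + 1) := by grind
    rw [hev.neg_one_pow]
    rcases hnext with h | h | ⟨-, h, -⟩
    · right; rw [h]; simp only [Nat.cast_zero, zero_add, sub_self, mul_zero]; positivity
    · left; rw [h]; push_cast; ring
    · omega
  | p, 0, h, hnext, hpq =>
    refine ⟨_, cycleClassSum_pred_apply_of_arm rfl hu.2 h, ?_⟩
    obtain rfl : p = m + 1 := by omega
    rcases hnext with h | h | ⟨-, -, h⟩
    · left; rw [h]; push_cast; ring
    · right; rw [h]; simp only [Nat.cast_zero, zero_add, add_neg_cancel, mul_zero]; positivity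
    · omega
  | p + 1, q + 1, h, hnext, hpq =>
    refine ⟨_, cycleClassSum_pred_apply_of_pos rfl hu.2 h, .inr ?_⟩
    refine nextContent_value_le ?_ heven hn (by omega)
    rcases hnext with h | h | ⟨h, -, -⟩
    · left; rw [h]; push_cast; ring
    · right; left; rw [h]; push_cast; ring
    · right; right; exact h

theorem eigenvalues_cycleClassSum_pred_of_even (heven : Even n) (hn : 5 < n) {μ : ℝ}
    (hμ : Module.End.HasEigenvalue (cycleClassSum (regularRep (Perm (Fin n))) (n - 1)) μ) :
    μ = ((n * (n - 2)! : ℕ) : ℝ) ∨ μ ≤ ((3 * (n - 3) * (n - 5)! : ℕ) : ℝ) := by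
  by_cases h0 : μ = 0
  · right; rw [h0]; positivity
  obtain ⟨m, hm⟩ : ∃ m, n = m + 3 := ⟨n - 3, by omega⟩
  obtain ⟨k, hk⟩ : ∃ k : Fin n, (k : ℕ) = m + 2 := ⟨⟨m + 2, by omega⟩, rfl⟩
  obtain ⟨v, hv⟩ := hμ.exists_hasEigenvector
  have hZv := hv.apply_eq_smul
  obtain ⟨i, hi⟩ : ∃ i : Fin n,
      cycleSum (regularRep (Perm (Fin n))) (m + 1) (regularRep _ (swap i k) v) ≠ 0 := by
    by_contra! h
    rw [cycleClassSum_pred _ hk hm, LinearMap.sum_apply] at hZv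
    simp only [Module.End.mul_apply, h, map_zero, Finset.sum_const_zero] at hZv
    exact (smul_ne_zero h0 hv.2) hZv.symm
  have hcomm : ∀ g, Commute (regularRep _ g) (cycleClassSum (regularRep (Perm (Fin n))) (n - 1)) :=
    fun g => commute_cycleClassSum _ _ g
  have hZ' : cycleClassSum (regularRep (Perm (Fin n))) (n - 1)
      (cycleSum (regularRep (Perm (Fin n))) (m + 1) (regularRep _ (swap i k) v)) =
      μ • cycleSum (regularRep (Perm (Fin n))) (m + 1) (regularRep _ (swap i k) v) := by
    have hcs : Commute (cycleSum (regularRep (Perm (Fin n))) (m + 1))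
        (cycleClassSum (regularRep (Perm (Fin n))) (n - 1)) := by
      classical
      exact Commute.sum_left _ _ _ fun g _ => hcomm g
    rw [← Module.End.mul_apply, ← hcs.eq, Module.End.mul_apply, ← Module.End.mul_apply _ _ v,
      ← (hcomm _).eq, Module.End.mul_apply, hZv, map_smul, map_smul]
  obtain ⟨u, e, hu, hin⟩ := exists_isJointEigenvector_inner_ne_zero hi
  have hCu := cycleSum_apply_of_jm (m := m + 1) _ (by omega) fun j _ => hu.2 j
  have hne : ∏ i ∈ Finset.range (m + 1), e (i + 1) ≠ 0 := by
    intro h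
    rw [← isSymmetric_cycleSum (m + 1), hCu, h, zero_smul, inner_zero_left] at hin
    exact hin rfl
  obtain ⟨p, q, h⟩ := (admissibleSpectra (n := n) (by omega)).exists_hookContents
    ⟨u, hu⟩ (m + 1) (by omega) hne
  obtain ⟨μ', h1, h2⟩ := eigenvalues_cycleClassSum_pred_of_hook heven hn hu (p := p) (q := q)
    (by rwa [show n - 2 = m + 1 by omega])
  rwa [← eq_of_inner_ne_zero (isSymmetric_cycleClassSum (n - 1)) h1 hZ' hin]

theorem hasEigenvalue_cycleClassSum_pred_top (hn : 3 ≤ n) :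
    Module.End.HasEigenvalue (cycleClassSum (regularRep (Perm (Fin n))) (n - 1))
      ((n * (n - 2)! : ℕ) : ℝ) := by
  obtain ⟨m, rfl⟩ : ∃ m, n = m + 3 := ⟨n - 3, by omega⟩
  obtain ⟨v, c, h0, -, h2, h3⟩ := exists_hookVector (n := m + 3) (m + 2) 0 (by omega)
  cases h3 with
  | arm h3 h4 =>
    refine Module.End.hasEigenvalue_of_hasEigenvector (x := v)
      ⟨Module.End.mem_eigenspace_iff.2 ?_, h0⟩
    rw [cycleClassSum_pred_apply_of_arm rfl (fun j => h2 j (by omega)) h3, h4]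
    congr 1
    rw [show m + 3 - 2 = m + 1 by omega]
    push_cast; ring

theorem hasEigenvalue_cycleClassSum_pred_second (hn : 5 < n) :
    Module.End.HasEigenvalue (cycleClassSum (regularRep (Perm (Fin n))) (n - 1))
      ((3 * (n - 3) * (n - 5)! : ℕ) : ℝ) := by
  obtain ⟨a, rfl⟩ : ∃ a, n = a + 5 := ⟨n - 5, by omega⟩
  obtain ⟨v, c, h0, h2, h3, h4⟩ := exists_extend_hookVector (n := a + 5) (a + 1) 2 (by omega)
    (by omega) (by omega)
  refine Module.End.hasEigenvalue_of_hasEigenvector (x := v)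
    ⟨Module.End.mem_eigenspace_iff.2 ?_, h0⟩
  rw [cycleClassSum_pred_apply_of_pos (m := a + 2) rfl (fun j => h2 j (by omega)) h3, h4]
  congr 1
  rw [show a + 5 - 5 = a by omega, show a + 5 - 3 = a + 2 by omega]
  push_cast; simp; ring

end Spectrum

section CayleyGraph

theorem mem_graphEigs_iff {V : Type*} [Fintype V] (Γ : SimpleGraph V) {μ : ℝ} :
    μ ∈ graphEigs Γ ↔
      ∃ f : V → ℝ, f ≠ 0 ∧ ∀ u, open Classical in ∑ w with Γ.Adj u w, f w = μ * f u := by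
  classical
  have h : graphEigs Γ = spectrum ℝ (Γ.adjMatrix ℝ) := by
    unfold graphEigs
    congr!
  rw [h, ← Matrix.spectrum_toLin', ← Module.End.hasEigenvalue_iff_mem_spectrum]
  have key : ∀ f : V → ℝ, Matrix.toLin' (Γ.adjMatrix ℝ) f = μ • f ↔
      ∀ u, ∑ w with Γ.Adj u w, f w = μ * f u := fun f => by
    rw [funext_iff]
    refine forall_congr' fun u => ?_
    rw [Matrix.toLin'_apply, SimpleGraph.adjMatrix_mulVec_apply, Pi.smul_apply, smul_eq_mul,
      SimpleGraph.neighborFinset_eq_filter]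
  constructor
  · intro h
    obtain ⟨f, hf⟩ := h.exists_hasEigenvector
    exact ⟨f, hf.2, (key f).1 hf.apply_eq_smul⟩
  · rintro ⟨f, hf, h⟩
    exact Module.End.hasEigenvalue_of_hasEigenvector (x := f)
      ⟨Module.End.mem_eigenspace_iff.2 ((key f).2 h), hf⟩

theorem cayleyGraph_adj_iff {G : Type*} [Group G] {H : Set G} (h1 : 1 ∉ H)
    (hinv : ∀ g, g ∈ H ↔ g⁻¹ ∈ H) {u w : G} : (cayleyGraph H).Adj u w ↔ u * w⁻¹ ∈ H := by
  rw [cayleyGraph, SimpleGraph.fromRel_adj]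
  refine ⟨fun h => h.2.elim id fun h => ?_, fun h => ⟨?_, .inl h⟩⟩
  · rw [hinv]; simpa using h
  · rintro rfl
    rw [mul_inv_cancel] at h
    exact h1 h

theorem mem_graphEigs_cayleyGraph_iff {G : Type*} [Group G] [Fintype G] {H : Set G} (h1 : 1 ∉ H)
    (hinv : ∀ g, g ∈ H ↔ g⁻¹ ∈ H) {μ : ℝ} :
    μ ∈ graphEigs (cayleyGraph H) ↔
      ∃ f : G → ℝ, f ≠ 0 ∧ ∀ u, open Classical in ∑ h with h ∈ H, f (h⁻¹ * u) = μ * f u := by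
  classical
  rw [mem_graphEigs_iff]
  refine exists_congr fun f => and_congr_right fun _ => forall_congr' fun u => ?_
  suffices h : ∑ w with (cayleyGraph H).Adj u w, f w = ∑ h with h ∈ H, f (h⁻¹ * u) by rw [h]
  refine Finset.sum_bij' (fun w _ => u * w⁻¹) (fun h _ => h⁻¹ * u) ?_ ?_ ?_ ?_ ?_ <;>
    simp +contextual [cayleyGraph_adj_iff h1 hinv]

variable {n k : ℕ}

theorem one_notMem_kCyclesAlt : (1 : alternatingGroup (Fin n)) ∉ kCyclesAlt n k :=
  fun h => h.1.ne_one rfl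

theorem mem_kCyclesAlt_iff_inv_mem (g : alternatingGroup (Fin n)) :
    g ∈ kCyclesAlt n k ↔ g⁻¹ ∈ kCyclesAlt n k := by
  simp [kCyclesAlt]

theorem mem_alternatingGroup_of_isCycle (hk : Odd k) {g : Perm (Fin n)} (hg : g.IsCycle)
    (hgk : g.support.card = k) : g ∈ alternatingGroup (Fin n) := by
  rw [Perm.mem_alternatingGroup, hg.sign, hgk, hk.neg_one_pow, neg_neg]

theorem closure_kCyclesAlt (hn : 5 ≤ n) (hk : Odd k) (hk2 : 2 ≤ k) (hkn : k ≤ n) :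
    Subgroup.closure (kCyclesAlt n k) = ⊤ := by
  have hconj : Group.conjugatesOfSet (kCyclesAlt n k) = kCyclesAlt n k := by
    refine Set.Subset.antisymm (fun x hx => ?_) Group.subset_conjugatesOfSet
    obtain ⟨a, ha, hax⟩ := Group.mem_conjugatesOfSet_iff.1 hx
    obtain ⟨b, rfl⟩ := isConj_iff.1 hax
    refine ⟨ha.1.conj, ?_⟩
    simpa using ha.2
  have hnormal : (Subgroup.closure (kCyclesAlt n k)).Normal := by
    rw [← hconj]
    exact Subgroup.normalClosure_normal
  have := alternatingGroup.isSimpleGroup (α := Fin n) (by simpa using hn)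
  refine (hnormal.eq_bot_or_eq_top).resolve_left fun hbot => ?_
  obtain ⟨g, hg⟩ := (Perm.exists_with_cycleType_iff (α := Fin n) (m := {k})).2
    (by simp [hk2, hkn])
  have hc : g.IsCycle := by rw [← Perm.card_cycleType_eq_one, hg, Multiset.card_singleton]
  have hs : g.support.card = k := by rw [← Perm.sum_cycleType, hg, Multiset.sum_singleton]
  have hmem : (⟨g, mem_alternatingGroup_of_isCycle hk hc hs⟩ : alternatingGroup (Fin n)) ∈
      Subgroup.closure (kCyclesAlt n k) := Subgroup.subset_closure ⟨hc, hs⟩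
  rw [hbot, Subgroup.mem_bot] at hmem
  exact hc.ne_one (congrArg Subtype.val hmem)

open Classical in
theorem sum_kCyclesAlt (hk : Odd k) (F : Perm (Fin n) → ℝ) :
    ∑ h with h ∈ kCyclesAlt n k, F h =
      ∑ g : Perm (Fin n) with g.IsCycle ∧ g.support.card = k, F g := by
  refine Finset.sum_bij (fun h _ => (h : Perm (Fin n))) ?_ ?_ ?_ fun _ _ => rfl
  · intro h hh
    rw [Finset.mem_filter] at hh ⊢
    exact ⟨Finset.mem_univ _, hh.2⟩
  · intro a _ b _ h
    exact Subtype.ext h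
  · intro g hg
    rw [Finset.mem_filter] at hg
    exact ⟨⟨g, mem_alternatingGroup_of_isCycle hk hg.2.1 hg.2.2⟩,
      Finset.mem_filter.2 ⟨Finset.mem_univ _, hg.2⟩, rfl⟩

theorem mem_graphEigs_kCyclesAlt_iff (hk : Odd k) {μ : ℝ} :
    μ ∈ graphEigs (cayleyGraph (kCyclesAlt n k)) ↔
      Module.End.HasEigenvalue (cycleClassSum (regularRep (Perm (Fin n))) k) μ := by
  classical
  rw [mem_graphEigs_cayleyGraph_iff one_notMem_kCyclesAlt mem_kCyclesAlt_iff_inv_mem]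
  have hZ : ∀ (v : EuclideanSpace ℝ (Perm (Fin n))) u,
      cycleClassSum (regularRep (Perm (Fin n))) k v u =
        ∑ h with h ∈ kCyclesAlt n k, v ((h : Perm (Fin n))⁻¹ * u) := fun v u => by
    rw [sum_kCyclesAlt hk fun g => v (g⁻¹ * u)]
    simp [cycleClassSum]
  constructor
  · rintro ⟨f, hf, h⟩
    obtain ⟨a, ha⟩ := Function.ne_iff.1 hf
    refine Module.End.hasEigenvalue_of_hasEigenvector (x := WithLp.toLp 2 fun g =>
      if hg : g ∈ alternatingGroup (Fin n) then f ⟨g, hg⟩ else 0)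
      ⟨Module.End.mem_eigenspace_iff.2 ?_, fun h0 => ha ?_⟩
    · ext u
      rw [hZ, PiLp.smul_apply, smul_eq_mul]
      dsimp only
      by_cases hu : u ∈ alternatingGroup (Fin n)
      · rw [dif_pos hu, ← h ⟨u, hu⟩]
        refine Finset.sum_congr rfl fun g _ => ?_
        rw [dif_pos (mul_mem (inv_mem g.2) hu)]
        rfl
      · rw [dif_neg hu, mul_zero]
        refine Finset.sum_eq_zero fun g _ => dif_neg ?_
        rwa [Subgroup.mul_mem_cancel_left _ (inv_mem g.2)]
    · have := congrArg (fun v : EuclideanSpace ℝ (Perm (Fin n)) => v a) h0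
      simpa using this
  · intro h
    obtain ⟨v, hv⟩ := h.exists_hasEigenvector
    obtain ⟨u, hu⟩ : ∃ u, v u ≠ 0 := by
      by_contra! h
      exact hv.2 (by ext u; simp [h])
    refine ⟨fun a => v (a * u), Function.ne_iff.2 ⟨1, by simpa using hu⟩, fun a => ?_⟩
    have := congrArg (fun w : EuclideanSpace ℝ (Perm (Fin n)) => w (a * u)) hv.apply_eq_smul
    simp only [hZ, PiLp.smul_apply, smul_eq_mul] at this
    rw [← this]
    simp [mul_assoc]

theorem isGreatest_graphEigs {s : Set ℝ} {a b : ℝ} (ha : a ∈ s) (hb : b ∈ s) (hab : b < a)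
    (h : ∀ μ ∈ s, μ = a ∨ μ ≤ b) : ∃ l, IsGreatest s l ∧ IsGreatest {μ | μ ∈ s ∧ μ < l} b :=
  ⟨a, ⟨ha, fun μ hμ => (h μ hμ).elim (fun h => h.le) fun h => h.trans hab.le⟩, ⟨hb, hab⟩,
    fun μ hμ => (h μ hμ.1).resolve_left hμ.2.ne⟩

end CayleyGraph

/-- Let `H` be the set of all `n`-cycles in `A_n` (for odd `n > 4`), respectively of all
`(n-1)`-cycles in `A_n` (for even `n > 5`).  Then `H` is a connecting set in `A_n` and the
second largest eigenvalue of `Cay(A_n,H)` equals `2·(n-3)!` (n odd), resp.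
`3(n-3)·(n-5)!` (n even). -/
theorem stmt13 (n : ℕ) :
    (Odd n → 4 < n →
      ((1 : alternatingGroup (Fin n)) ∉ kCyclesAlt n n ∧
        (∀ g, g ∈ kCyclesAlt n n ↔ g⁻¹ ∈ kCyclesAlt n n) ∧
        Subgroup.closure (kCyclesAlt n n) = ⊤) ∧
      ∃ l1 : ℝ, IsGreatest (graphEigs (cayleyGraph (kCyclesAlt n n))) l1 ∧
        IsGreatest {μ : ℝ | μ ∈ graphEigs (cayleyGraph (kCyclesAlt n n)) ∧ μ < l1}
          ((2 * (n - 3).factorial : ℕ) : ℝ)) ∧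
    (Even n → 5 < n →
      ((1 : alternatingGroup (Fin n)) ∉ kCyclesAlt n (n - 1) ∧
        (∀ g, g ∈ kCyclesAlt n (n - 1) ↔ g⁻¹ ∈ kCyclesAlt n (n - 1)) ∧
        Subgroup.closure (kCyclesAlt n (n - 1)) = ⊤) ∧
      ∃ l1 : ℝ, IsGreatest (graphEigs (cayleyGraph (kCyclesAlt n (n - 1)))) l1 ∧
        IsGreatest {μ : ℝ | μ ∈ graphEigs (cayleyGraph (kCyclesAlt n (n - 1))) ∧ μ < l1}
          ((3 * (n - 3) * (n - 5).factorial : ℕ) : ℝ)) := by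
  refine ⟨fun hodd hn => ⟨⟨one_notMem_kCyclesAlt, mem_kCyclesAlt_iff_inv_mem,
    closure_kCyclesAlt (by omega) hodd (by omega) le_rfl⟩, ?_⟩, fun heven hn => ?_⟩
  · refine isGreatest_graphEigs (a := ((n - 1).factorial : ℕ)) ?_ ?_ ?_ fun μ hμ => ?_
    · rw [mem_graphEigs_kCyclesAlt_iff hodd]
      simpa using hasEigenvalue_cycleClassSum_of_add_eq (n := n) (p := n - 1) (q := 0) (by omega)
        (by omega)
    · rw [mem_graphEigs_kCyclesAlt_iff hodd]
      have := hasEigenvalue_cycleClassSum_of_add_eq (n := n) (p := n - 3) (q := 2) (by omega)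
        (by omega)
      simpa [mul_comm] using this
    · obtain ⟨a, rfl⟩ : ∃ a, n = a + 5 := ⟨n - 5, by omega⟩
      rw [show a + 5 - 1 = (a + 2) + 1 + 1 by omega, show a + 5 - 3 = a + 2 by omega,
        Nat.factorial_succ (a + 2 + 1), Nat.factorial_succ (a + 2)]
      have h1 : 2 < (a + 2 + 1 + 1) * (a + 2 + 1) := by nlinarith [Nat.zero_le (a * a)]
      have := Nat.mul_lt_mul_of_pos_right h1 (Nat.factorial_pos (a + 2))
      exact_mod_cast this.trans_eq (by ring)
    · exact eigenvalues_cycleClassSum_of_odd hodd hn ((mem_graphEigs_kCyclesAlt_iff hodd).1 hμ)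
  · have hodd : Odd (n - 1) := Nat.Even.sub_odd (by omega) heven odd_one
    refine ⟨⟨one_notMem_kCyclesAlt, mem_kCyclesAlt_iff_inv_mem,
      closure_kCyclesAlt (by omega) hodd (by omega) (by omega)⟩, ?_⟩
    refine isGreatest_graphEigs (a := (n * (n - 2).factorial : ℕ)) ?_ ?_ ?_ fun μ hμ => ?_
    · rw [mem_graphEigs_kCyclesAlt_iff hodd]
      exact hasEigenvalue_cycleClassSum_pred_top (by omega)
    · rw [mem_graphEigs_kCyclesAlt_iff hodd]
      exact hasEigenvalue_cycleClassSum_pred_second hn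
    · obtain ⟨a, rfl⟩ : ∃ a, n = a + 5 := ⟨n - 5, by omega⟩
      rw [show a + 5 - 2 = a + 1 + 1 + 1 by omega, show a + 5 - 3 = a + 2 by omega,
        show a + 5 - 5 = a by omega, Nat.factorial_succ (a + 1 + 1),
        Nat.factorial_succ (a + 1), Nat.factorial_succ a]
      have h1 : 3 * (a + 2) < (a + 5) * ((a + 1 + 1 + 1) * ((a + 1 + 1) * (a + 1))) := by
        nlinarith [Nat.zero_le (a * a), Nat.zero_le (a * a * a), Nat.zero_le (a * a * a * a)]
      have := Nat.mul_lt_mul_of_pos_right h1 (Nat.factorial_pos a)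
      exact_mod_cast this.trans_eq (by ring)
    · exact eigenvalues_cycleClassSum_pred_of_even heven hn
        ((mem_graphEigs_kCyclesAlt_iff hodd).1 hμ)
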